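/- Let NE = {(d₁₁,d₁₂,d₂₁,d₂₂,d₃₁,d₃₂) ∈ ℤ⁶ : d₁₂ = d₁₁−d₃₁+d₃₂, d₂₂ = d₂₁−d₃₁+d₃₂, d₁₁+d₂₂ ≥ 0, d₂₁+d₃₂ ≥ 0, d₃₁+d₁₂ ≥ 0, d₁₁+d₂₂+d₃₁ ≥ 0, d₁₂+d₂₁+d₃₂ ≥ 0}, and for d ∈ NE set δ(d) = Σ_{i,j} d_{ij}, e₁(d) = 2(d₁₁+d₂₂+d₃₁), e₂(d) = δ(d), e₃(d) = 2(d₁₂+d₂₁+d₃₂) (all nonnegative on NE). In R = ℚ[[x₁₁,x₂₁,x₃₁,x₃₂]] put x₁₂ = x₁₁−x₃₁+x₃₂, x₂₂ = x₂₁−x₃₁+x₃₂, D₁ = 2x₁₁+2x₂₂+2x₃₁, D₂ = x₁₁+x₁₂+x₂₁+x₂₂+x₃₁+x₃₂, D₃ = 2x₁₂+2x₂₁+2x₃₂; for an integer e and an R-element y with constant term 0 define Φ_e(y) = (∏_{m=1}^{e}(y+m))^{−1} if e ≥ 0 (each factor y+m is invertible) and Φ_e(y) = ∏_{m=e+1}^{0}(y+m)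 if e < 0. For d ∈ NE set T_d = (x₁₁−x₂₁+d₁₁−d₂₁)(x₁₁−x₃₁+d₁₁−d₃₁)(x₂₁−x₃₁+d₂₁−d₃₁)(x₁₂−x₁₁+d₁₂−d₁₁) · ∏_{i=1}^{3} ∏_{m=1}^{e_i(d)}(D_i+m) · ∏_{1≤i≤3,1≤j≤2} Φ_{d_{ij}}(x_{ij})³ ∈ R. Then: (i) for each δ ≥ 0 the set {d ∈ NE : δ(d) = δ} is finite, so F_δ := Σ_{d∈NE, δ(d)=δ} T_d ∈ R is well defined; (ii) F_δ is divisible in R by ω := (x₁₁−x₂₁)(x₁₁−x₃₁)(x₂₁−x₃₁)(x₁₂−x₁₁); and (iii) setting a_δ := (−1)^δ·(constant term of F_δ/ω), the formal power series I₀(q) = Σ_{δ≥0} a_δ q^δ ∈ ℚ[[q]] (with a₀ = 1, a₁ = 6, a₂ = 66, a₃ = 1092) satisfies the fourth-order differential equation {θ⁴ − 2q(2θ²+2θ+1)(11θ²+11θ+3) + 4q²(θ+1)²(76θ²+152θ+111) − 144q³(θ+1)(θ+2)(2θ+3)²} I₀ = 0. -/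

import Mathlib

noncomputable section
namespace Stmt14

/-- The ring `R = ℚ[[x₁₁, x₂₁, x₃₁, x₃₂]]` (variables indexed `0,1,2,3`). -/
abbrev R := MvPowerSeries (Fin 4) ℚ

/-- The constant `a` in `R`. -/
def Cc (a : ℚ) : R := MvPowerSeries.C a

def x11 : R := MvPowerSeries.X 0
def x21 : R := MvPowerSeries.X 1
def x31 : R := MvPowerSeries.X 2
def x32 : R := MvPowerSeries.X 3
/-- `x₁₂ = x₁₁ − x₃₁ + x₃₂`. -/
def x12 : R := x11 - x31 + x32
/-- `x₂₂ = x₂₁ − x₃₁ + x₃₂`. -/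
def x22 : R := x21 - x31 + x32

/-- `D₁ = 2x₁₁ + 2x₂₂ + 2x₃₁`. -/
def D1 : R := 2 * x11 + 2 * x22 + 2 * x31
/-- `D₂ = x₁₁ + x₁₂ + x₂₁ + x₂₂ + x₃₁ + x₃₂`. -/
def D2 : R := x11 + x12 + x21 + x22 + x31 + x32
/-- `D₃ = 2x₁₂ + 2x₂₁ + 2x₃₂`. -/
def D3 : R := 2 * x12 + 2 * x21 + 2 * x32

/-- `Φ_e(y)`: for `e ≥ 0` the inverse of `∏_{m=1}^{e}(y+m)`, for `e < 0` the product
`∏_{m=e+1}^{0}(y+m)`. -/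
def Phi (e : ℤ) (y : R) : R :=
  if 0 ≤ e then (∏ m ∈ Finset.Icc (1 : ℤ) e, (y + Cc (m : ℚ)))⁻¹
  else ∏ m ∈ Finset.Icc (e + 1) (0 : ℤ), (y + Cc (m : ℚ))

/-- The semigroup `NE` of effective classes: tuples
`(d₁₁, d₁₂, d₂₁, d₂₂, d₃₁, d₃₂)` (indexed `0,…,5`) with
`d₁₂ = d₁₁ − d₃₁ + d₃₂`, `d₂₂ = d₂₁ − d₃₁ + d₃₂`, `d₁₁+d₂₂ ≥ 0`, `d₂₁+d₃₂ ≥ 0`,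
`d₃₁+d₁₂ ≥ 0`, `d₁₁+d₂₂+d₃₁ ≥ 0`, `d₁₂+d₂₁+d₃₂ ≥ 0`. -/
def NE : Set (Fin 6 → ℤ) :=
  {d | d 1 = d 0 - d 4 + d 5 ∧ d 3 = d 2 - d 4 + d 5 ∧
    0 ≤ d 0 + d 3 ∧ 0 ≤ d 2 + d 5 ∧ 0 ≤ d 4 + d 1 ∧
    0 ≤ d 0 + d 3 + d 4 ∧ 0 ≤ d 1 + d 2 + d 5}

/-- `δ(d) = Σ_{i,j} d_{ij}`. -/
def deg (d : Fin 6 → ℤ) : ℤ := ∑ i, d i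

/-- `e₁(d) = 2(d₁₁+d₂₂+d₃₁)`. -/
def e1 (d : Fin 6 → ℤ) : ℤ := 2 * (d 0 + d 3 + d 4)
/-- `e₂(d) = δ(d)`. -/
def e2 (d : Fin 6 → ℤ) : ℤ := deg d
/-- `e₃(d) = 2(d₁₂+d₂₁+d₃₂)`. -/
def e3 (d : Fin 6 → ℤ) : ℤ := 2 * (d 1 + d 2 + d 5)

/-- The term `T_d` of the twisted `I`-function of the determinantal nets of conics. -/
def T (d : Fin 6 → ℤ) : R :=
  (x11 - x21 + Cc ((d 0 - d 2 : ℤ) : ℚ)) * (x11 - x31 + Cc ((d 0 - d 4 : ℤ) : ℚ)) *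
    (x21 - x31 + Cc ((d 2 - d 4 : ℤ) : ℚ)) * (x12 - x11 + Cc ((d 1 - d 0 : ℤ) : ℚ)) *
    (∏ m ∈ Finset.Icc (1 : ℤ) (e1 d), (D1 + Cc (m : ℚ))) *
    (∏ m ∈ Finset.Icc (1 : ℤ) (e2 d), (D2 + Cc (m : ℚ))) *
    (∏ m ∈ Finset.Icc (1 : ℤ) (e3 d), (D3 + Cc (m : ℚ))) *
    (Phi (d 0) x11) ^ 3 * (Phi (d 1) x12) ^ 3 * (Phi (d 2) x21) ^ 3 *
    (Phi (d 3) x22) ^ 3 * (Phi (d 4) x31) ^ 3 * (Phi (d 5) x32) ^ 3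

/-- `F_δ = Σ_{d ∈ NE, δ(d) = δ} T_d` (a finite sum, by part (i) of the theorem). -/
def F (δ : ℕ) : R := ∑ᶠ d ∈ {d : Fin 6 → ℤ | d ∈ NE ∧ deg d = (δ : ℤ)}, T d

/-- The fundamental Weyl anti-invariant class
`ω = (x₁₁−x₂₁)(x₁₁−x₃₁)(x₂₁−x₃₁)(x₁₂−x₁₁)`. -/
def ω : R := (x11 - x21) * (x11 - x31) * (x21 - x31) * (x12 - x11)

/-- The Euler operator `θ = q·d/dq` on `ℚ[[q]]`. -/
def th (f : PowerSeries ℚ) : PowerSeries ℚ :=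
  PowerSeries.mk fun d => (d : ℚ) * PowerSeries.coeff d f

/-- Factors of a hypergeometric weight on the lattice `ℤ³ × ℤ²` with values in `K`. -/
structure Weight (K : Type*) [CommRing K] where
  P : Fin 3 → K
  X : Fin 2 → K
  φ : Fin 3 → Fin 2 → ℤ → K
  N : Fin 2 → ℤ → K
  P_sum : P 0 + P 1 + P 2 = 0
  X_sum : X 0 + X 1 = 0
  φ_step : ∀ i j e, φ i j e = (X j - P i + (e : K) + 1) * φ i j (e + 1)
  N_step : ∀ j A, N j (A + 1) = (2 * ((A : K) + X j) + 1) * (2 * ((A : K) + X j) + 2) * N j A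

namespace Weight
variable {K : Type*} [CommRing K] (Ω : Weight K)

/-- The value of the weight at the lattice point `(p₁, p₂, p₃, A₁, A₂)`. -/
def val (p₁ p₂ p₃ A₁ A₂ : ℤ) : K :=
  Ω.N 0 A₁ * Ω.N 1 A₂ *
    (Ω.φ 0 0 (A₁ - p₁) ^ 3 * Ω.φ 1 0 (A₁ - p₂) ^ 3 * Ω.φ 2 0 (A₁ - p₃) ^ 3) *
    (Ω.φ 0 1 (A₂ - p₁) ^ 3 * Ω.φ 1 1 (A₂ - p₂) ^ 3 * Ω.φ 2 1 (A₂ - p₃) ^ 3)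

/-- The weight on the slice `p₁ + p₂ + p₃ = m`, `A₁ + A₂ = m'`, in the coordinates
`(p₁, p₂, A₁)`. -/
def slice (m m' : ℤ) (z : ℤ × ℤ × ℤ) : K :=
  Ω.val z.1 z.2.1 (m - z.1 - z.2.1) z.2.2 (m' - z.2.2)

/-- The value of `f` at the lattice point `z` of a slice, shifted by the classes `P` and `X`. -/
def evalAt (m m' : ℤ) (z : ℤ × ℤ × ℤ) (f : K → K → K → K → K → K) : K :=
  f (z.1 + Ω.P 0) (z.2.1 + Ω.P 1) (m - (z.1 + Ω.P 0) - (z.2.1 + Ω.P 1))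
    (z.2.2 + Ω.X 0) (m' - (z.2.2 + Ω.X 0))

open Classical in
/-- Summation of `f` against the weight on a slice (zero if the weight has infinite support). -/
def S (m m' : ℤ) : (K → K → K → K → K → K) →ₗ[K] K where
  toFun f := if h : (Function.support (Ω.slice m m')).Finite then
    ∑ z ∈ h.toFinset, Ω.evalAt m m' z f * Ω.slice m m' z else 0
  map_add' f g := by
    split_ifs
    · simp [evalAt, add_mul, Finset.sum_add_distrib]
    · simp
  map_smul' r f := by
    split_ifs
    · simp [evalAt, Finset.mul_sum, mul_assoc]
    · simp

/-- All slices entering the contiguity relations have finite support. -/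
def FiniteSlices : Prop :=
  ∀ m m' : ℤ, -2 ≤ m → -1 ≤ m' → (Function.support (Ω.slice m m')).Finite

variable {Ω}

theorem S_eq_finsum {m m' : ℤ} (h : (Function.support (Ω.slice m m')).Finite)
    (f : K → K → K → K → K → K) :
    Ω.S m m' f = ∑ᶠ z, Ω.evalAt m m' z f * Ω.slice m m' z := by
  rw [finsum_eq_sum_of_support_subset (s := h.toFinset)]
  · simp [S, h]
  · intro z hz
    simp only [Set.Finite.coe_toFinset, Function.mem_support] at hz ⊢
    exact right_ne_zero_of_mul hz

variable (Ω) in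
theorem S_congr {m m' : ℤ} {f g : K → K → K → K → K → K}
    (h : ∀ a b c : K, f a b (m - a - b) c (m' - c) = g a b (m - a - b) c (m' - c)) :
    Ω.S m m' f = Ω.S m m' g := by
  simp [S, evalAt, h]

/-- The factor of `φ(d + δ)` in the contiguity relation between `φ(d + δ)` and `φ(d)`. -/
def up (δ : ℤ) (y : K) : K := if δ = 1 then y ^ 3 else 1

/-- The factor of `φ(d)` in the contiguity relation between `φ(d + δ)` and `φ(d)`. -/
def lo (δ : ℤ) (y : K) : K := if δ = -1 then y ^ 3 else 1

/-- The ratio of `N(A + t)` and `N(A)`. -/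
def num (t : ℤ) (y : K) : K := if t = 1 then (2 * y + 1) * (2 * y + 2) else 1

/-- The shifts of the lattice occurring in the contiguity relations. -/
def Small (s₁ s₂ s₃ t₁ t₂ : ℤ) : Prop :=
  (0 ≤ t₁ ∧ t₁ ≤ 1) ∧ (0 ≤ t₂ ∧ t₂ ≤ 1) ∧
  (-1 ≤ t₁ - s₁ ∧ t₁ - s₁ ≤ 1) ∧ (-1 ≤ t₁ - s₂ ∧ t₁ - s₂ ≤ 1) ∧ (-1 ≤ t₁ - s₃ ∧ t₁ - s₃ ≤ 1) ∧
  (-1 ≤ t₂ - s₁ ∧ t₂ - s₁ ≤ 1) ∧ (-1 ≤ t₂ - s₂ ∧ t₂ - s₂ ≤ 1) ∧ (-1 ≤ t₂ - s₃ ∧ t₂ - s₃ ≤ 1)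

variable (Ω) in
theorem φ_shift (i : Fin 3) (j : Fin 2) {δ : ℤ} (h : -1 ≤ δ ∧ δ ≤ 1) (e e' : ℤ) (h' : e' = e + δ)
    (y y' : K) (hy : y = e + (Ω.X j - Ω.P i)) (hy' : y' = e' + (Ω.X j - Ω.P i)) :
    up δ y' * Ω.φ i j e' ^ 3 = lo δ y * Ω.φ i j e ^ 3 := by
  subst h' hy hy'
  have : δ = -1 ∨ δ = 0 ∨ δ = 1 := by omega
  rcases this with rfl | rfl | rfl
  · have := Ω.φ_step i j (e + -1)
    simp only [up, lo, this]
    simp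
    ring
  · simp [up, lo]
  · rw [Ω.φ_step i j e]
    simp [up, lo]
    ring

variable (Ω) in
theorem N_shift (j : Fin 2) {t : ℤ} (h : 0 ≤ t ∧ t ≤ 1) (A A' : ℤ) (h' : A' = A + t)
    (y : K) (hy : y = A + Ω.X j) : Ω.N j A' = num t y * Ω.N j A := by
  subst h' hy
  have : t = 0 ∨ t = 1 := by omega
  rcases this with rfl | rfl
  · simp [num]
  · simp [num, Ω.N_step]

/-- The factor attached to the endpoint of a shift. -/
def upper (s₁ s₂ s₃ t₁ t₂ : ℤ) (p₁ p₂ p₃ A₁ A₂ : K) : K :=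
  up (t₁ - s₁) (A₁ - p₁) * up (t₁ - s₂) (A₁ - p₂) * up (t₁ - s₃) (A₁ - p₃) *
    (up (t₂ - s₁) (A₂ - p₁) * up (t₂ - s₂) (A₂ - p₂) * up (t₂ - s₃) (A₂ - p₃))

/-- The factor attached to the starting point of a shift. -/
def lower (s₁ s₂ s₃ t₁ t₂ : ℤ) (p₁ p₂ p₃ A₁ A₂ : K) : K :=
  num t₁ A₁ * num t₂ A₂ *
    (lo (t₁ - s₁) (A₁ - p₁) * lo (t₁ - s₂) (A₁ - p₂) * lo (t₁ - s₃) (A₁ - p₃)) *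
    (lo (t₂ - s₁) (A₂ - p₁) * lo (t₂ - s₂) (A₂ - p₂) * lo (t₂ - s₃) (A₂ - p₃))

theorem slice_shift (s₁ s₂ s₃ t₁ t₂ : ℤ) (hs : Small s₁ s₂ s₃ t₁ t₂) (m m' : ℤ) (z : ℤ × ℤ × ℤ) :
    Ω.evalAt (m + s₁ + s₂ + s₃) (m' + t₁ + t₂) (z + (s₁, s₂, t₁)) (upper s₁ s₂ s₃ t₁ t₂) *
      Ω.slice (m + s₁ + s₂ + s₃) (m' + t₁ + t₂) (z + (s₁, s₂, t₁)) =
    Ω.evalAt m m' z (lower s₁ s₂ s₃ t₁ t₂) * Ω.slice m m' z := by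
  obtain ⟨p, q, A⟩ := z
  obtain ⟨h1, h2, h11, h12, h13, h21, h22, h23⟩ := hs
  have hP : Ω.P 2 = - Ω.P 0 - Ω.P 1 := by linear_combination Ω.P_sum
  have hX : Ω.X 1 = - Ω.X 0 := by linear_combination Ω.X_sum
  simp only [evalAt, slice, val, upper, lower, Prod.mk_add_mk]
  rw [Ω.N_shift 0 h1 A _ rfl _ rfl,
    Ω.N_shift 1 h2 (m' - A) (m' + t₁ + t₂ - (A + t₁)) (by ring) (m' - (A + Ω.X 0))
      (by rw [hX]; push_cast; ring)]
  have k11 := Ω.φ_shift 0 0 h11 (A - p) (A + t₁ - (p + s₁)) (by ring)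
    (A + Ω.X 0 - (p + Ω.P 0)) (((A + t₁ : ℤ) : K) + Ω.X 0 - (((p + s₁ : ℤ) : K) + Ω.P 0))
    (by push_cast; ring) (by push_cast; ring)
  have k12 := Ω.φ_shift 1 0 h12 (A - q) (A + t₁ - (q + s₂)) (by ring)
    (A + Ω.X 0 - (q + Ω.P 1)) (((A + t₁ : ℤ) : K) + Ω.X 0 - (((q + s₂ : ℤ) : K) + Ω.P 1))
    (by push_cast; ring) (by push_cast; ring)
  have k13 := Ω.φ_shift 2 0 h13 (A - (m - p - q))
    (A + t₁ - (m + s₁ + s₂ + s₃ - (p + s₁) - (q + s₂))) (by ring)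
    (A + Ω.X 0 - (m - (p + Ω.P 0) - (q + Ω.P 1)))
    (((A + t₁ : ℤ) : K) + Ω.X 0 - (((m + s₁ + s₂ + s₃ : ℤ) : K) - (((p + s₁ : ℤ) : K) + Ω.P 0) -
      (((q + s₂ : ℤ) : K) + Ω.P 1)))
    (by rw [hP]; push_cast; ring) (by rw [hP]; push_cast; ring)
  have k21 := Ω.φ_shift 0 1 h21 (m' - A - p) (m' + t₁ + t₂ - (A + t₁) - (p + s₁)) (by ring)
    (m' - (A + Ω.X 0) - (p + Ω.P 0))
    (((m' + t₁ + t₂ : ℤ) : K) - (((A + t₁ : ℤ) : K) + Ω.X 0) - (((p + s₁ : ℤ) : K) + Ω.P 0))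
    (by rw [hX]; push_cast; ring) (by rw [hX]; push_cast; ring)
  have k22 := Ω.φ_shift 1 1 h22 (m' - A - q) (m' + t₁ + t₂ - (A + t₁) - (q + s₂)) (by ring)
    (m' - (A + Ω.X 0) - (q + Ω.P 1))
    (((m' + t₁ + t₂ : ℤ) : K) - (((A + t₁ : ℤ) : K) + Ω.X 0) - (((q + s₂ : ℤ) : K) + Ω.P 1))
    (by rw [hX]; push_cast; ring) (by rw [hX]; push_cast; ring)
  have k23 := Ω.φ_shift 2 1 h23 (m' - A - (m - p - q))
    (m' + t₁ + t₂ - (A + t₁) - (m + s₁ + s₂ + s₃ - (p + s₁) - (q + s₂))) (by ring)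
    (m' - (A + Ω.X 0) - (m - (p + Ω.P 0) - (q + Ω.P 1)))
    (((m' + t₁ + t₂ : ℤ) : K) - (((A + t₁ : ℤ) : K) + Ω.X 0) -
      (((m + s₁ + s₂ + s₃ : ℤ) : K) - (((p + s₁ : ℤ) : K) + Ω.P 0) - (((q + s₂ : ℤ) : K) + Ω.P 1)))
    (by rw [hP, hX]; push_cast; ring) (by rw [hP, hX]; push_cast; ring)
  have := congrArg₂ (· * ·) (congrArg₂ (· * ·) k11 (congrArg₂ (· * ·) k12 k13))
    (congrArg₂ (· * ·) k21 (congrArg₂ (· * ·) k22 k23))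
  linear_combination (num t₁ (A + Ω.X 0) * Ω.N 0 A * (num t₂ (m' - (A + Ω.X 0)) *
    Ω.N 1 (m' - A))) * this

/-- Contiguity: shifting the lattice transforms sums over one slice into sums over another. -/
theorem S_shift (hΩ : Ω.FiniteSlices) (s₁ s₂ s₃ t₁ t₂ : ℤ) (hs : Small s₁ s₂ s₃ t₁ t₂) {m m' : ℤ}
    (hm : -2 ≤ m) (hm' : -1 ≤ m') {M M' : ℤ} (hM : M = m + s₁ + s₂ + s₃)
    (hM' : M' = m' + t₁ + t₂) (hM2 : -2 ≤ M) (hM1 : -1 ≤ M')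
    (f : K → K → K → K → K → K) :
    Ω.S M M' (fun p₁ p₂ p₃ A₁ A₂ => f p₁ p₂ p₃ A₁ A₂ * upper s₁ s₂ s₃ t₁ t₂ p₁ p₂ p₃ A₁ A₂) =
    Ω.S m m' (fun p₁ p₂ p₃ A₁ A₂ => f (p₁ + s₁) (p₂ + s₂) (p₃ + s₃) (A₁ + t₁) (A₂ + t₂) *
      lower s₁ s₂ s₃ t₁ t₂ p₁ p₂ p₃ A₁ A₂) := by
  subst hM hM'
  rw [S_eq_finsum (hΩ _ _ hM2 hM1), S_eq_finsum (hΩ _ _ hm hm'),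
    ← finsum_comp_equiv (Equiv.addRight ((s₁, s₂, t₁) : ℤ × ℤ × ℤ))]
  refine finsum_congr fun z => ?_
  have h := slice_shift (Ω := Ω) s₁ s₂ s₃ t₁ t₂ hs m m' z
  have h2 : Ω.evalAt (m + s₁ + s₂ + s₃) (m' + t₁ + t₂) (z + (s₁, s₂, t₁)) f =
      Ω.evalAt m m' z (fun p₁ p₂ p₃ A₁ A₂ =>
        f (p₁ + s₁) (p₂ + s₂) (p₃ + s₃) (A₁ + t₁) (A₂ + t₂)) := by
    simp only [evalAt, Prod.fst_add, Prod.snd_add]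
    congr 1 <;> push_cast <;> ring
  simp only [Equiv.coe_addRight]
  simp only [evalAt] at h h2 ⊢
  rw [mul_assoc, h, h2, mul_assoc]


/-- The antisymmetrisation of `h` under permutations of the `pᵢ` and of the `Aⱼ`. -/
def alt (h : K → K → K → K → K → K) (p₁ p₂ p₃ A₁ A₂ : K) : K :=
  h p₁ p₂ p₃ A₁ A₂ + h p₂ p₃ p₁ A₁ A₂ + h p₃ p₁ p₂ A₁ A₂ - h p₁ p₃ p₂ A₁ A₂
    - h p₃ p₂ p₁ A₁ A₂ - h p₂ p₁ p₃ A₁ A₂ - h p₁ p₂ p₃ A₂ A₁ - h p₂ p₃ p₁ A₂ A₁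
    - h p₃ p₁ p₂ A₂ A₁ + h p₁ p₃ p₂ A₂ A₁ + h p₃ p₂ p₁ A₂ A₁ + h p₂ p₁ p₃ A₂ A₁

/-- Contiguity for antisymmetrised summands. -/
theorem S_alt (hΩ : Ω.FiniteSlices) (s₁ s₂ s₃ t₁ t₂ : ℤ) (hs : Small s₁ s₂ s₃ t₁ t₂) {m m' : ℤ}
    (hm : -2 ≤ m) (hm' : -1 ≤ m') {M M' : ℤ} (hM : M = m + s₁ + s₂ + s₃)
    (hM' : M' = m' + t₁ + t₂) (hM2 : -2 ≤ M) (hM1 : -1 ≤ M')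
    (g h h' : K → K → K → K → K → K)
    (hh : ∀ p₁ p₂ p₃ A₁ A₂, h p₁ p₂ p₃ A₁ A₂ =
      g p₁ p₂ p₃ A₁ A₂ * upper s₁ s₂ s₃ t₁ t₂ p₁ p₂ p₃ A₁ A₂)
    (hh' : ∀ p₁ p₂ p₃ A₁ A₂, h' p₁ p₂ p₃ A₁ A₂ =
      g (p₁ + s₁) (p₂ + s₂) (p₃ + s₃) (A₁ + t₁) (A₂ + t₂) *
        lower s₁ s₂ s₃ t₁ t₂ p₁ p₂ p₃ A₁ A₂) :
    Ω.S M M' (alt h) = Ω.S m m' (alt h') := by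
  have link : ∀ (u l : K → K → K → K → K → K) (a b c d e : ℤ), Small a b c d e →
      M = m + a + b + c → M' = m' + d + e → ∀ f : K → K → K → K → K → K,
      (∀ p₁ p₂ p₃ A₁ A₂, u p₁ p₂ p₃ A₁ A₂ =
        f p₁ p₂ p₃ A₁ A₂ * upper a b c d e p₁ p₂ p₃ A₁ A₂) →
      (∀ p₁ p₂ p₃ A₁ A₂, l p₁ p₂ p₃ A₁ A₂ =
        f (p₁ + a) (p₂ + b) (p₃ + c) (A₁ + d) (A₂ + e) * lower a b c d e p₁ p₂ p₃ A₁ A₂) →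
      Ω.S M M' u = Ω.S m m' l := by
    intro u l a b c d e hs' h₁ h₂ f hu hl
    obtain rfl : u = _ := by funext p₁ p₂ p₃ A₁ A₂; exact hu p₁ p₂ p₃ A₁ A₂
    obtain rfl : l = _ := by funext p₁ p₂ p₃ A₁ A₂; exact hl p₁ p₂ p₃ A₁ A₂
    exact S_shift hΩ a b c d e hs' hm hm' h₁ h₂ hM2 hM1 f
  obtain ⟨_, _, _, _, _, _, _, _⟩ := hs
  have k0 := link (fun p₁ p₂ p₃ A₁ A₂ => h p₁ p₂ p₃ A₁ A₂)
    (fun p₁ p₂ p₃ A₁ A₂ => h' p₁ p₂ p₃ A₁ A₂)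
    s₁ s₂ s₃ t₁ t₂ (by unfold Small; tauto) (by linarith) (by linarith)
    (fun p₁ p₂ p₃ A₁ A₂ => g p₁ p₂ p₃ A₁ A₂)
    hh hh'
  have k1 := link (fun p₁ p₂ p₃ A₁ A₂ => h p₂ p₃ p₁ A₁ A₂)
    (fun p₁ p₂ p₃ A₁ A₂ => h' p₂ p₃ p₁ A₁ A₂)
    s₃ s₁ s₂ t₁ t₂ (by unfold Small; tauto) (by linarith) (by linarith)
    (fun p₁ p₂ p₃ A₁ A₂ => g p₂ p₃ p₁ A₁ A₂)
    (by intros; simp only [hh, upper]; ring) (by intros; simp only [hh', lower]; ring)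
  have k2 := link (fun p₁ p₂ p₃ A₁ A₂ => h p₃ p₁ p₂ A₁ A₂)
    (fun p₁ p₂ p₃ A₁ A₂ => h' p₃ p₁ p₂ A₁ A₂)
    s₂ s₃ s₁ t₁ t₂ (by unfold Small; tauto) (by linarith) (by linarith)
    (fun p₁ p₂ p₃ A₁ A₂ => g p₃ p₁ p₂ A₁ A₂)
    (by intros; simp only [hh, upper]; ring) (by intros; simp only [hh', lower]; ring)
  have k3 := link (fun p₁ p₂ p₃ A₁ A₂ => h p₁ p₃ p₂ A₁ A₂)
    (fun p₁ p₂ p₃ A₁ A₂ => h' p₁ p₃ p₂ A₁ A₂)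
    s₁ s₃ s₂ t₁ t₂ (by unfold Small; tauto) (by linarith) (by linarith)
    (fun p₁ p₂ p₃ A₁ A₂ => g p₁ p₃ p₂ A₁ A₂)
    (by intros; simp only [hh, upper]; ring) (by intros; simp only [hh', lower]; ring)
  have k4 := link (fun p₁ p₂ p₃ A₁ A₂ => h p₃ p₂ p₁ A₁ A₂)
    (fun p₁ p₂ p₃ A₁ A₂ => h' p₃ p₂ p₁ A₁ A₂)
    s₃ s₂ s₁ t₁ t₂ (by unfold Small; tauto) (by linarith) (by linarith)
    (fun p₁ p₂ p₃ A₁ A₂ => g p₃ p₂ p₁ A₁ A₂)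
    (by intros; simp only [hh, upper]; ring) (by intros; simp only [hh', lower]; ring)
  have k5 := link (fun p₁ p₂ p₃ A₁ A₂ => h p₂ p₁ p₃ A₁ A₂)
    (fun p₁ p₂ p₃ A₁ A₂ => h' p₂ p₁ p₃ A₁ A₂)
    s₂ s₁ s₃ t₁ t₂ (by unfold Small; tauto) (by linarith) (by linarith)
    (fun p₁ p₂ p₃ A₁ A₂ => g p₂ p₁ p₃ A₁ A₂)
    (by intros; simp only [hh, upper]; ring) (by intros; simp only [hh', lower]; ring)
  have k6 := link (fun p₁ p₂ p₃ A₁ A₂ => h p₁ p₂ p₃ A₂ A₁)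
    (fun p₁ p₂ p₃ A₁ A₂ => h' p₁ p₂ p₃ A₂ A₁)
    s₁ s₂ s₃ t₂ t₁ (by unfold Small; tauto) (by linarith) (by linarith)
    (fun p₁ p₂ p₃ A₁ A₂ => g p₁ p₂ p₃ A₂ A₁)
    (by intros; simp only [hh, upper]; ring) (by intros; simp only [hh', lower]; ring)
  have k7 := link (fun p₁ p₂ p₃ A₁ A₂ => h p₂ p₃ p₁ A₂ A₁)
    (fun p₁ p₂ p₃ A₁ A₂ => h' p₂ p₃ p₁ A₂ A₁)
    s₃ s₁ s₂ t₂ t₁ (by unfold Small; tauto) (by linarith) (by linarith)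
    (fun p₁ p₂ p₃ A₁ A₂ => g p₂ p₃ p₁ A₂ A₁)
    (by intros; simp only [hh, upper]; ring) (by intros; simp only [hh', lower]; ring)
  have k8 := link (fun p₁ p₂ p₃ A₁ A₂ => h p₃ p₁ p₂ A₂ A₁)
    (fun p₁ p₂ p₃ A₁ A₂ => h' p₃ p₁ p₂ A₂ A₁)
    s₂ s₃ s₁ t₂ t₁ (by unfold Small; tauto) (by linarith) (by linarith)
    (fun p₁ p₂ p₃ A₁ A₂ => g p₃ p₁ p₂ A₂ A₁)
    (by intros; simp only [hh, upper]; ring) (by intros; simp only [hh', lower]; ring)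
  have k9 := link (fun p₁ p₂ p₃ A₁ A₂ => h p₁ p₃ p₂ A₂ A₁)
    (fun p₁ p₂ p₃ A₁ A₂ => h' p₁ p₃ p₂ A₂ A₁)
    s₁ s₃ s₂ t₂ t₁ (by unfold Small; tauto) (by linarith) (by linarith)
    (fun p₁ p₂ p₃ A₁ A₂ => g p₁ p₃ p₂ A₂ A₁)
    (by intros; simp only [hh, upper]; ring) (by intros; simp only [hh', lower]; ring)
  have k10 := link (fun p₁ p₂ p₃ A₁ A₂ => h p₃ p₂ p₁ A₂ A₁)
    (fun p₁ p₂ p₃ A₁ A₂ => h' p₃ p₂ p₁ A₂ A₁)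
    s₃ s₂ s₁ t₂ t₁ (by unfold Small; tauto) (by linarith) (by linarith)
    (fun p₁ p₂ p₃ A₁ A₂ => g p₃ p₂ p₁ A₂ A₁)
    (by intros; simp only [hh, upper]; ring) (by intros; simp only [hh', lower]; ring)
  have k11 := link (fun p₁ p₂ p₃ A₁ A₂ => h p₂ p₁ p₃ A₂ A₁)
    (fun p₁ p₂ p₃ A₁ A₂ => h' p₂ p₁ p₃ A₂ A₁)
    s₂ s₁ s₃ t₂ t₁ (by unfold Small; tauto) (by linarith) (by linarith)
    (fun p₁ p₂ p₃ A₁ A₂ => g p₂ p₁ p₃ A₂ A₁)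
    (by intros; simp only [hh, upper]; ring) (by intros; simp only [hh', lower]; ring)
  have expand : ∀ h : K → K → K → K → K → K, alt h =
      (fun p₁ p₂ p₃ A₁ A₂ => h p₁ p₂ p₃ A₁ A₂) + (fun p₁ p₂ p₃ A₁ A₂ => h p₂ p₃ p₁ A₁ A₂)
      + (fun p₁ p₂ p₃ A₁ A₂ => h p₃ p₁ p₂ A₁ A₂) - (fun p₁ p₂ p₃ A₁ A₂ => h p₁ p₃ p₂ A₁ A₂)
      - (fun p₁ p₂ p₃ A₁ A₂ => h p₃ p₂ p₁ A₁ A₂) - (fun p₁ p₂ p₃ A₁ A₂ => h p₂ p₁ p₃ A₁ A₂)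
      - (fun p₁ p₂ p₃ A₁ A₂ => h p₁ p₂ p₃ A₂ A₁) - (fun p₁ p₂ p₃ A₁ A₂ => h p₂ p₃ p₁ A₂ A₁)
      - (fun p₁ p₂ p₃ A₁ A₂ => h p₃ p₁ p₂ A₂ A₁) + (fun p₁ p₂ p₃ A₁ A₂ => h p₁ p₃ p₂ A₂ A₁)
      + (fun p₁ p₂ p₃ A₁ A₂ => h p₃ p₂ p₁ A₂ A₁) + (fun p₁ p₂ p₃ A₁ A₂ => h p₂ p₁ p₃ A₂ A₁) :=
        fun _ => rfl
  rw [expand h, expand h']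
  simp only [LinearMap.map_add, LinearMap.map_sub]
  linear_combination k0 + k1 + k2 - k3 - k4 - k5 - k6 - k7 - k8 + k9 + k10 + k11


/-- The product of the Vandermonde determinants of the `pᵢ` and of the `Aⱼ`. -/
def vdm (p₁ p₂ p₃ A₁ A₂ : K) : K := (p₁ - p₂) * (p₁ - p₃) * (p₂ - p₃) * (A₁ - A₂)

/-- A monomial in the elementary symmetric functions `A₁A₂`, `e₂(p)` and `e₃(p)`. -/
def symm (k : ℕ × ℕ × ℕ) (c e₂ e₃ : K) : K := c ^ k.1 * e₂ ^ k.2.1 * e₃ ^ k.2.2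

/-- The Vandermonde product times a monomial in the elementary symmetric functions. -/
def mono (k : ℕ × ℕ × ℕ) (p₁ p₂ p₃ A₁ A₂ : K) : K :=
  symm k (A₁ * A₂) (p₁ * p₂ + p₁ * p₃ + p₂ * p₃) (p₁ * p₂ * p₃) * vdm p₁ p₂ p₃ A₁ A₂

variable (Ω) in
/-- The moments of the weight on a slice. -/
def mom (m m' : ℤ) (a b c : ℕ) : K := Ω.S m m' (mono (a, b, c))

/-- `p`, `q`, `r` are the roots of `x³ - mx² + e₂x - e₃` and `A`, `B` those of `x² - m'x + c`. -/
structure Roots (m m' e₂ e₃ c p q r A B : K) : Prop where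
  sum₃ : p + q + r = m
  sum₂ : A + B = m'
  pairs : p * q + p * r + q * r = e₂
  prod₃ : p * q * r = e₃
  prod₂ : A * B = c

namespace Roots
variable {m m' e₂ e₃ c p q r A B : K}

theorem rotate (h : Roots m m' e₂ e₃ c p q r A B) : Roots m m' e₂ e₃ c q r p A B where
  sum₃ := by rw [← h.sum₃]; ring
  sum₂ := h.sum₂
  pairs := by rw [← h.pairs]; ring
  prod₃ := by rw [← h.prod₃]; ring
  prod₂ := h.prod₂

theorem swap (h : Roots m m' e₂ e₃ c p q r A B) : Roots m m' e₂ e₃ c p q r B A where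
  sum₃ := h.sum₃
  sum₂ := by rw [← h.sum₂]; ring
  pairs := h.pairs
  prod₃ := h.prod₃
  prod₂ := by rw [← h.prod₂]; ring

theorem cube (h : Roots m m' e₂ e₃ c p q r A B) : p ^ 3 = m * p ^ 2 - e₂ * p + e₃ := by
  rw [← h.sum₃, ← h.pairs, ← h.prod₃]; ring

theorem sq (h : Roots m m' e₂ e₃ c p q r A B) : A ^ 2 = m' * A - c := by
  rw [← h.sum₂, ← h.prod₂]; ring

end Roots

/-- The coefficient of `p²A` in the reduction of
`(v₂p² + v₁p + v₀)(w₁A + w₀)((a₂p² + a₁p + a₀)A + (b₂p² + b₁p + b₀))` modulo the equations of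
the roots. -/
def lead (m m' e₂ v₀ v₁ v₂ w₀ w₁ a₀ a₁ a₂ b₀ b₁ b₂ : K) : K :=
  v₂ * (w₀ * a₀ + w₁ * b₀ + m' * w₁ * a₀) +
    (v₁ + m * v₂) * (w₀ * a₁ + w₁ * b₁ + m' * w₁ * a₁) +
    (v₀ + m * v₁ + (m ^ 2 - e₂) * v₂) * (w₀ * a₂ + w₁ * b₂ + m' * w₁ * a₂)

theorem alt_rotate (f : K → K → K → K → K → K) (p q r A B : K) :
    alt (fun p q r A B => f q r p A B) p q r A B = alt f p q r A B := by
  unfold alt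
  ring

/-- An alternating sum depends only on the leading coefficient of its reduction modulo the
equations of the roots. -/
theorem Roots.alt_eq {m m' e₂ e₃ c p q r A B : K} (h : Roots m m' e₂ e₃ c p q r A B)
    {f : K → K → K → K → K → K} {α : K} (β γ δ ε ζ : K)
    (hf : ∀ p q r A B, Roots m m' e₂ e₃ c p q r A B → f p q r A B - f p r q A B =
      (q - r) * (α * p ^ 2 * A + β * p ^ 2 + γ * p * A + δ * p + ε * A + ζ)) :
    alt f p q r A B = α * vdm p q r A B := by
  have h₁ := hf _ _ _ _ _ h
  have h₂ := hf _ _ _ _ _ h.rotate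
  have h₃ := hf _ _ _ _ _ h.rotate.rotate
  have h₄ := hf _ _ _ _ _ h.swap
  have h₅ := hf _ _ _ _ _ h.rotate.swap
  have h₆ := hf _ _ _ _ _ h.rotate.rotate.swap
  unfold alt vdm
  linear_combination h₁ + h₂ + h₃ - h₄ - h₅ - h₆

theorem Roots.alt_mul {m m' e₂ e₃ c p q r A B : K} (h : Roots m m' e₂ e₃ c p q r A B)
    {f u : K → K → K → K → K → K} (v₀ v₁ v₂ w₀ w₁ : K) {a₀ a₁ a₂ b₀ b₁ b₂ : K}
    (hu : ∀ p q r A B, Roots m m' e₂ e₃ c p q r A B → u p q r A B =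
      (a₂ * p ^ 2 + a₁ * p + a₀) * A + (b₂ * p ^ 2 + b₁ * p + b₀))
    (hf : ∀ p q r A B, Roots m m' e₂ e₃ c p q r A B → f p q r A B - f p r q A B =
      (q - r) * ((v₂ * p ^ 2 + v₁ * p + v₀) * (w₁ * A + w₀) * u p q r A B)) :
    alt f p q r A B = lead m m' e₂ v₀ v₁ v₂ w₀ w₁ a₀ a₁ a₂ b₀ b₁ b₂ * vdm p q r A B := by
  obtain ⟨x₀, hx₀⟩ : ∃ x, x = w₀ * a₀ + w₁ * b₀ + m' * w₁ * a₀ := ⟨_, rfl⟩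
  obtain ⟨x₁, hx₁⟩ : ∃ x, x = w₀ * a₁ + w₁ * b₁ + m' * w₁ * a₁ := ⟨_, rfl⟩
  obtain ⟨x₂, hx₂⟩ : ∃ x, x = w₀ * a₂ + w₁ * b₂ + m' * w₁ * a₂ := ⟨_, rfl⟩
  obtain ⟨y₀, hy₀⟩ : ∃ y, y = w₀ * b₀ - c * w₁ * a₀ := ⟨_, rfl⟩
  obtain ⟨y₁, hy₁⟩ : ∃ y, y = w₀ * b₁ - c * w₁ * a₁ := ⟨_, rfl⟩
  obtain ⟨y₂, hy₂⟩ : ∃ y, y = w₀ * b₂ - c * w₁ * a₂ := ⟨_, rfl⟩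
  have hxy : ∀ p q r A B, Roots m m' e₂ e₃ c p q r A B → f p q r A B - f p r q A B =
      (q - r) * ((v₂ * p ^ 2 + v₁ * p + v₀) *
        ((x₂ * p ^ 2 + x₁ * p + x₀) * A + (y₂ * p ^ 2 + y₁ * p + y₀))) := by
    intro p q r A B h
    rw [hf p q r A B h, hu p q r A B h, hx₀, hx₁, hx₂, hy₀, hy₁, hy₂]
    linear_combination (q - r) * (v₂ * p ^ 2 + v₁ * p + v₀) * w₁ *
      (a₂ * p ^ 2 + a₁ * p + a₀) * h.sq
  rw [lead, ← hx₀, ← hx₁, ← hx₂]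
  refine h.alt_eq (v₂ * y₀ + (v₁ + m * v₂) * y₁ + (v₀ + m * v₁ + (m ^ 2 - e₂) * v₂) * y₂)
    (v₀ * x₁ + v₁ * x₀ - e₂ * (v₁ * x₂ + v₂ * x₁) + (e₃ - m * e₂) * v₂ * x₂)
    (v₀ * y₁ + v₁ * y₀ - e₂ * (v₁ * y₂ + v₂ * y₁) + (e₃ - m * e₂) * v₂ * y₂)
    (v₀ * x₀ + e₃ * (v₁ * x₂ + v₂ * x₁) + m * e₃ * v₂ * x₂)
    (v₀ * y₀ + e₃ * (v₁ * y₂ + v₂ * y₁) + m * e₃ * v₂ * y₂) fun p q r A B h => ?_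
  rw [hxy p q r A B h]
  linear_combination (q - r) * ((v₁ * x₂ + v₂ * x₁ + v₂ * x₂ * (p + m)) * A +
    (v₁ * y₂ + v₂ * y₁ + v₂ * y₂ * (p + m))) * h.cube

theorem Roots.alt_mul_rotate {m m' e₂ e₃ c p q r A B : K} (h : Roots m m' e₂ e₃ c p q r A B)
    {f u : K → K → K → K → K → K} (v₀ v₁ v₂ w₀ w₁ : K) {a₀ a₁ a₂ b₀ b₁ b₂ : K}
    (hu : ∀ p q r A B, Roots m m' e₂ e₃ c p q r A B → u p q r A B =
      (a₂ * p ^ 2 + a₁ * p + a₀) * A + (b₂ * p ^ 2 + b₁ * p + b₀))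
    (hf : ∀ p q r A B, Roots m m' e₂ e₃ c p q r A B → f q r p A B - f r q p A B =
      (q - r) * ((v₂ * p ^ 2 + v₁ * p + v₀) * (w₁ * A + w₀) * u p q r A B)) :
    alt f p q r A B = lead m m' e₂ v₀ v₁ v₂ w₀ w₁ a₀ a₁ a₂ b₀ b₁ b₂ * vdm p q r A B :=
  (alt_rotate f p q r A B).symm.trans (h.alt_mul v₀ v₁ v₂ w₀ w₁ hu hf)

theorem S_eq_sum_mom {m m' : ℤ} (L : List (K × ℕ × ℕ × ℕ)) (f : K → K → K → K → K → K)
    (h : ∀ e₂ e₃ c p q r A B : K, Roots (m : K) (m' : K) e₂ e₃ c p q r A B → f p q r A B =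
      (L.map fun k => k.1 * symm k.2 c e₂ e₃).sum * vdm p q r A B) :
    Ω.S m m' f = (L.map fun k => k.1 * Ω.mom m m' k.2.1 k.2.2.1 k.2.2.2).sum := by
  have key : Ω.S m m' (L.map fun k => k.1 • mono k.2).sum =
      (L.map fun k => k.1 * Ω.mom m m' k.2.1 k.2.2.1 k.2.2.2).sum := by
    clear h
    induction L with
    | nil => simp
    | cons k L ih =>
      simp only [List.map_cons, List.sum_cons, LinearMap.map_add, ih, LinearMap.map_smul]
      rfl
  rw [← key]
  refine Ω.S_congr fun a b c => (h _ _ _ a b _ c _ ⟨by ring, by ring, rfl, rfl, rfl⟩).trans ?_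
  clear h key
  induction L with
  | nil => simp
  | cons k L ih =>
    simp only [List.map_cons, List.sum_cons, add_mul, ih]
    simp [mono, mul_assoc]

theorem mom_row (hΩ : Ω.FiniteSlices) (s₁ s₂ s₃ t₁ t₂ : ℤ) (hs : Small s₁ s₂ s₃ t₁ t₂) {m m' : ℤ}
    (hm : -2 ≤ m) (hm' : -1 ≤ m') {M M' : ℤ} (hM : M = m + s₁ + s₂ + s₃)
    (hM' : M' = m' + t₁ + t₂) (hM2 : -2 ≤ M) (hM1 : -1 ≤ M')
    (g : K → K → K → K → K → K) (L L' : List (K × ℕ × ℕ × ℕ))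
    (h : ∀ μ μ' : K, (M : K) = μ → (M' : K) = μ' → ∀ e₂ e₃ c p q r A B,
      Roots μ μ' e₂ e₃ c p q r A B →
      alt (fun p q r A B => g p q r A B * upper s₁ s₂ s₃ t₁ t₂ p q r A B) p q r A B =
        (L.map fun k => k.1 * symm k.2 c e₂ e₃).sum * vdm p q r A B)
    (h' : ∀ μ μ' : K, (m : K) = μ → (m' : K) = μ' → ∀ e₂ e₃ c p q r A B,
      Roots μ μ' e₂ e₃ c p q r A B →
      alt (fun p q r A B => g (p + s₁) (q + s₂) (r + s₃) (A + t₁) (B + t₂) *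
          lower s₁ s₂ s₃ t₁ t₂ p q r A B) p q r A B =
        (L'.map fun k => k.1 * symm k.2 c e₂ e₃).sum * vdm p q r A B) :
    (L.map fun k => k.1 * Ω.mom M M' k.2.1 k.2.2.1 k.2.2.2).sum =
      (L'.map fun k => k.1 * Ω.mom m m' k.2.1 k.2.2.1 k.2.2.2).sum := by
  rw [← S_eq_sum_mom L _ (h _ _ rfl rfl), ← S_eq_sum_mom L' _ (h' _ _ rfl rfl)]
  exact S_alt hΩ s₁ s₂ s₃ t₁ t₂ hs hm hm' hM hM' hM2 hM1 g _ _ (fun _ _ _ _ _ => rfl)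
    (fun _ _ _ _ _ => rfl)

namespace Roots
variable {m m' e₂ e₃ c p q r A B : K}

theorem cube_mul_cube (h : Roots m m e₂ e₃ c p q r A B) :
    (A - q) ^ 3 * (A - r) ^ 3 =
      ((m ^ 3 - 4 * m * c + 3 * e₃) * p ^ 2 + (-m ^ 2 * e₂ + e₂ * c + 3 * c ^ 2) * p + (m ^ 2 *
        e₃ + 3 * e₂ * e₃ - 7 * e₃ * c)) * A + ((-m ^ 2 * c - m * e₃ + e₂ ^ 2 - 3 * e₂ * c + 6 * c
        ^ 2) * p ^ 2 + (m ^ 2 * e₃ - m * e₂ ^ 2 + 4 * m * e₂ * c - 3 * m * c ^ 2 + e₂ * e₃ - 6 *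
        e₃ * c) * p + (-2 * m * e₂ * e₃ + 2 * m * e₃ * c + e₂ ^ 3 - 3 * e₂ ^ 2 * c + 3 * e₂ * c ^
        2 - c ^ 3 + e₃ ^ 2)) := by
  have h₁ : (A - q) * (A - r) = p ^ 2 + p * A - p * m + e₂ - c := by
    linear_combination h.sq + (-p - A) * h.sum₃ + h.pairs
  have h₂ : ((A - q) * (A - r)) ^ 2 =
      p ^ 2 * A * m + p ^ 2 * e₂ - 3 * p ^ 2 * c - 2 * p * A * c - p * m * e₂ + 2 * p * m * c + p
      * e₃ + 2 * A * e₃ - m * e₃ + e₂ ^ 2 - 2 * e₂ * c + c ^ 2 := by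
    rw [h₁]
    linear_combination (p + 2 * A - m) * h.cube +
      (p ^ 2) * h.sq
  rw [← mul_pow, pow_succ _ 2, h₂, h₁]
  linear_combination (p * A * m + A ^ 2 * m + p * e₂ - 3 * p * c + A * e₂ - 5 * A * c - m * e₂ +
    2 * m * c + e₃) * h.cube +
    (p ^ 2 * m ^ 2 - 2 * p ^ 2 * c - p * m * e₂ + 2 * p * e₃ + m * e₃) * h.sq

theorem cube_mul_cube_succ (h : Roots m (m + 1) e₂ e₃ c p q r A B) :
    (A - q) ^ 3 * (A - r) ^ 3 =
      ((m ^ 3 + 5 * m ^ 2 - 4 * m * c + 10 * m + 3 * e₂ + 3 * e₃ - 12 * c + 6) * p ^ 2 + (-m ^ 2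
        * e₂ - 5 * m * e₂ + e₂ * c + 3 * c ^ 2 + 3 * m - e₂ + 6 * e₃ - 9 * c + 3) * p + (m ^ 2 *
        e₃ + m ^ 2 + 3 * m * e₂ + 5 * m * e₃ - 3 * m * c + 3 * e₂ ^ 2 + 3 * e₂ * e₃ - 6 * e₂ * c -
        7 * e₃ * c + 3 * c ^ 2 + 2 * m + 3 * e₂ + 7 * e₃ - 4 * c + 1)) * A + ((-m ^ 2 * c - m * e₃
        - 4 * m * c + e₂ ^ 2 - 3 * e₂ * c + 6 * c ^ 2 - 6 * c) * p ^ 2 + (m ^ 2 * e₃ - m * e₂ ^ 2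
        + 4 * m * e₂ * c - 3 * m * c ^ 2 + e₂ * e₃ + e₂ * c - 6 * e₃ * c + 6 * c ^ 2 - 3 * c) * p
        + (-2 * m * e₂ * e₃ + 2 * m * e₃ * c + e₂ ^ 3 - 3 * e₂ ^ 2 * c + 3 * e₂ * c ^ 2 - c ^ 3 -
        m * c - 3 * e₂ * c + e₃ ^ 2 - 7 * e₃ * c + 3 * c ^ 2 - c)) := by
  have h₁ : (A - q) * (A - r) = p ^ 2 + p * A - p * m + A + e₂ - c := by
    linear_combination h.sq + (-p - A) * h.sum₃ + h.pairs
  have h₂ : ((A - q) * (A - r)) ^ 2 =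
      p ^ 2 * A * m + 3 * p ^ 2 * A + p ^ 2 * e₂ - 3 * p ^ 2 * c - 2 * p * A * c - p * m * e₂ + 2
      * p * m * c + 2 * p * A + p * e₃ - 2 * p * c + A * m + 2 * A * e₂ + 2 * A * e₃ - 2 * A * c -
      m * e₃ + e₂ ^ 2 - 2 * e₂ * c + c ^ 2 + A - c := by
    rw [h₁]
    linear_combination (p + 2 * A - m) * h.cube +
      (p ^ 2 + 2 * p + 1) * h.sq
  rw [← mul_pow, pow_succ _ 2, h₂, h₁]
  linear_combination (p * A * m + A ^ 2 * m + 3 * p * A + p * e₂ - 3 * p * c + 3 * A ^ 2 + A * e₂ -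
    5 * A * c - m *
    e₂ + 2 * m * c + 2 * A + e₃ - 2 * c) * h.cube +
    (p ^ 2 * m ^ 2 + 4 * p ^ 2 * m - 2 * p ^ 2 * c - p * m * e₂ + 5 * p ^ 2 + p * m - p * e₂ + 2 *
    p * e₃ - 4 * p * c + m * e₃ + 3 * p + m + 2 * e₂ + 5 * e₃ - 2 * c + 1) * h.sq

theorem swap_cube_mul_cube_succ (h : Roots m (m + 1) e₂ e₃ c p q r A B) :
    (B - q) ^ 3 * (B - r) ^ 3 =
      ((-m ^ 3 - 5 * m ^ 2 + 4 * m * c - 10 * m - 3 * e₂ - 3 * e₃ + 12 * c - 6) * p ^ 2 + (m ^ 2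
        * e₂ + 5 * m * e₂ - e₂ * c - 3 * c ^ 2 - 3 * m + e₂ - 6 * e₃ + 9 * c - 3) * p + (-m ^ 2 *
        e₃ - m ^ 2 - 3 * m * e₂ - 5 * m * e₃ + 3 * m * c - 3 * e₂ ^ 2 - 3 * e₂ * e₃ + 6 * e₂ * c +
        7 * e₃ * c - 3 * c ^ 2 - 2 * m - 3 * e₂ - 7 * e₃ + 4 * c - 1)) * A + ((m ^ 4 + 6 * m ^ 3 -
        5 * m ^ 2 * c + 15 * m ^ 2 + 3 * m * e₂ + 2 * m * e₃ - 20 * m * c + e₂ ^ 2 - 3 * e₂ * c +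
        6 * c ^ 2 + 16 * m + 3 * e₂ + 3 * e₃ - 18 * c + 6) * p ^ 2 + (-m ^ 3 * e₂ - 6 * m ^ 2 * e₂
        + m ^ 2 * e₃ - m * e₂ ^ 2 + 5 * m * e₂ * c + 3 * m ^ 2 - 6 * m * e₂ + 6 * m * e₃ - 9 * m *
        c + e₂ * e₃ + 2 * e₂ * c - 6 * e₃ * c + 9 * c ^ 2 + 6 * m - e₂ + 6 * e₃ - 12 * c + 3) * p
        + (m ^ 3 * e₃ + m ^ 3 + 3 * m ^ 2 * e₂ + 6 * m ^ 2 * e₃ - 3 * m ^ 2 * c + 3 * m * e₂ ^ 2 +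
        m * e₂ * e₃ - 6 * m * e₂ * c - 5 * m * e₃ * c + 3 * m * c ^ 2 + e₂ ^ 3 - 3 * e₂ ^ 2 * c +
        3 * e₂ * c ^ 2 - c ^ 3 + 3 * m ^ 2 + 6 * m * e₂ + 12 * m * e₃ - 8 * m * c + 3 * e₂ ^ 2 + 3
        * e₂ * e₃ - 9 * e₂ * c + e₃ ^ 2 - 14 * e₃ * c + 6 * c ^ 2 + 3 * m + 3 * e₂ + 7 * e₃ - 5 *
        c + 1)) := by
  rw [h.swap.cube_mul_cube_succ, ← sub_eq_of_eq_add' h.sum₂.symm]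
  ring

theorem diag_cube (h : Roots m m e₂ e₃ c p q r A B) :
    (A - p) ^ 3 * (B - p) ^ 3 =
      (0 * p ^ 2 + 0 * p + 0) * A + ((-m * e₃ + e₂ ^ 2 - 3 * e₂ * c + 3 * c ^ 2) * p ^ 2 + (m ^
        2 * e₃ - m * e₂ ^ 2 + 3 * m * e₂ * c - 3 * m * c ^ 2 - 2 * e₂ * e₃ + 3 * e₃ * c) * p + (m
        * e₂ * e₃ - 3 * m * e₃ * c + c ^ 3 + e₃ ^ 2)) := by
  have h₁ : (A - p) * (B - p) = p ^ 2 - m * p + c := by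
    linear_combination -p * h.sum₂ + h.prod₂
  rw [← mul_pow, h₁]
  linear_combination (p ^ 3 - 2 * p ^ 2 * m + p * m ^ 2 - p * e₂ + 3 * p * c + m * e₂ - 3 * m * c +
    e₃) * h.cube

theorem diag_cube_succ (h : Roots m (m + 1) e₂ e₃ c p q r A B) :
    (A - p) ^ 3 * (B - p) ^ 3 =
      (0 * p ^ 2 + 0 * p + 0) * A + ((-m * e₃ + e₂ ^ 2 - 3 * e₂ * c + 3 * c ^ 2 - m - 3 * e₂ - 3
        * e₃ + 3 * c) * p ^ 2 + (m ^ 2 * e₃ - m * e₂ ^ 2 + 3 * m * e₂ * c - 3 * m * c ^ 2 + 3 * m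
        * e₃ - 3 * e₂ ^ 2 - 2 * e₂ * e₃ + 6 * e₂ * c + 3 * e₃ * c - 3 * c ^ 2 + e₂ + 3 * e₃) * p +
        (m * e₂ * e₃ - 3 * m * e₃ * c + c ^ 3 + 3 * e₂ * e₃ + e₃ ^ 2 - 6 * e₃ * c - e₃)) := by
  have h₁ : (A - p) * (B - p) = p ^ 2 - (m + 1) * p + c := by
    linear_combination -p * h.sum₂ + h.prod₂
  rw [← mul_pow, h₁]
  linear_combination (p ^ 3 - 2 * p ^ 2 * m + p * m ^ 2 - 3 * p ^ 2 + 3 * p * m - p * e₂ +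
    3 * p * c + m * e₂ - 3 *
    m * c + 3 * p + 3 * e₂ + e₃ - 6 * c - 1) * h.cube

theorem num_mul_cube (h : Roots m m e₂ e₃ c p q r A B) :
    (2 * A + 1) * (2 * A + 2) * (B - p) ^ 3 =
      ((-4 * m ^ 2 - 6 * m + 12 * c - 6) * p ^ 2 + (4 * m * e₂ + 6 * m + 6 * e₂ + 18 * c) * p +
        (-2 * m ^ 2 - 4 * m * e₃ - 6 * m * c - 4 * c ^ 2 - 6 * e₃ + 2 * c)) * A + ((4 * m * c + 4
        * m + 18 * c) * p ^ 2 + (-6 * m ^ 2 - 18 * m * c - 4 * e₂ * c - 12 * c ^ 2 + 2 * e₂ + 6 *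
        c) * p + (2 * m ^ 3 + 6 * m ^ 2 * c + 4 * m * c ^ 2 - 4 * m * c + 4 * e₃ * c - 6 * c ^ 2 -
        2 * e₃)) := by
  rw [← sub_eq_of_eq_add' h.sum₂.symm]
  linear_combination (-4 * A ^ 2 - 6 * A - 2) * h.cube +
    (-12 * p ^ 2 * A - 4 * p ^ 2 * m - 12 * p * A ^ 2 + 12 * p * A * m - 4 * A ^ 3 + 8 * A ^ 2 * m
    - 4 * A * m ^ 2 - 18 * p ^ 2 - 18 * p * A + 18 * p * m + 4 * p * e₂ + 12 * p * c - 6 * A ^ 2 +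
    12 * A * m + 4 * A * c - 6 * m ^ 2 - 4 * m * c - 6 * p - 2 * A + 4 * m - 4 * e₃ + 6 * c) * h.sq

theorem sub_cube (h : Roots m m e₂ e₃ c p q r A B) :
    (A - p) ^ 3 =
      (3 * p ^ 2 + (-3 * m) * p + (m ^ 2 - c)) * A + ((-m) * p ^ 2 + (e₂ + 3 * c) * p + (-m * c
        - e₃)) := by
  linear_combination (-1) * h.cube +
    (-3 * p + A + m) * h.sq

end Roots

theorem row_pa_q (hΩ : Ω.FiniteSlices) {n : ℤ} (hn : -1 ≤ n) :
    (-4 * (n : K) - 4) * Ω.mom (n + 1) (n + 1) 1 0 0 + 3 * Ω.mom (n + 1) (n + 1) 0 0 1 +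
        ((n : K) ^ 3 + 3 * (n : K) ^ 2 + 3 * (n : K) + 1) * Ω.mom (n + 1) (n + 1) 0 0 0 =
      12 * Ω.mom n n 1 0 0 + (-4 * (n : K) ^ 2 - 6 * (n : K) - 6) * Ω.mom n n 0 0 0 := by
  have h := mom_row hΩ 1 0 0 1 0 (by norm_num [Small]) (m := n) (m' := n)
    (M := n + 1) (M' := n + 1) (by linarith) (by linarith) (by ring) (by ring)
    (by linarith) (by linarith) (fun p q r A B => q)
    [(-4 * (n : K) - 4, 1, 0, 0), (3, 0, 0, 1), ((n : K) ^ 3 + 3 * (n : K) ^ 2 + 3 * (n : K) +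
      1, 0, 0, 0)]
    [(12, 1, 0, 0), (-4 * (n : K) ^ 2 - 6 * (n : K) - 6, 0, 0, 0)]
    (by
      intro m m' hm hm' e₂ e₃ c p q r A B h
      push_cast at hm hm'
      have hn' : (n : K) = m - 1 := by linear_combination hm
      obtain rfl : m = m' := by linear_combination hm' - hm
      refine (h.alt_mul 1 0 0 1 0 (fun _ _ _ _ _ h => h.cube_mul_cube)
        fun p q r A B h => ?_).trans (congrArg (· * vdm p q r A B) ?_)
      · simp only [upper, up]
        norm_num
        ring
      · simp only [lead, symm, List.map_cons, List.map_nil, List.sum_cons, List.sum_nil, hn']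
        ring)
    (by
      intro m m' hm hm' e₂ e₃ c p q r A B h
      have hn' : (n : K) = m := by linear_combination hm
      obtain rfl : m = m' := by linear_combination hm' - hm
      refine (h.alt_mul 1 0 0 1 0 (fun _ _ _ _ _ h => h.num_mul_cube)
        fun p q r A B h => ?_).trans (congrArg (· * vdm p q r A B) ?_)
      · simp only [lower, lo, num]
        norm_num
        ring
      · simp only [lead, symm, List.map_cons, List.map_nil, List.sum_cons, List.sum_nil, hn']
        ring)
  simp only [List.map_cons, List.map_nil, List.sum_cons, List.sum_nil] at h
  linear_combination h

theorem row_pp_A_e (hΩ : Ω.FiniteSlices) {n : ℤ} (hn : -1 ≤ n) :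
    3 * Ω.mom n n 2 0 0 + (-3) * Ω.mom n n 1 1 0 + 1 * Ω.mom n n 0 2 0 +
        (-(n : K)) * Ω.mom n n 0 0 1 =
      0 := by
  have h := mom_row hΩ 1 0 (-1) 0 0 (by norm_num [Small]) (m := n) (m' := n)
    (M := n) (M' := n) (by linarith) (by linarith) (by ring) (by ring)
    (by linarith) (by linarith) (fun p q r A B => A * (p * q + p * r + q * r))
    []
    [(-3, 2, 0, 0), (3, 1, 1, 0), (-1, 0, 2, 0), ((n : K), 0, 0, 1)]
    (by
      intro m m' hm hm' e₂ e₃ c p q r A B h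
      obtain rfl : m = m' := by linear_combination hm' - hm
      refine (h.alt_mul_rotate 0 0 0 0 0 (fun _ _ _ _ _ h => h.diag_cube)
        fun p q r A B h => ?_).trans (congrArg (· * vdm p q r A B) ?_)
      · simp only [upper, up]
        norm_num
        ring
      · simp only [lead, List.map_nil, List.sum_nil]
        ring)
    (by
      intro m m' hm hm' e₂ e₃ c p q r A B h
      have hn' : (n : K) = m := by linear_combination hm
      obtain rfl : m = m' := by linear_combination hm' - hm
      refine (h.alt_mul 1 0 0 0 (-1) (fun _ _ _ _ _ h => h.diag_cube)
        fun p q r A B h => ?_).trans (congrArg (· * vdm p q r A B) ?_)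
      · simp only [lower, lo, num]
        norm_num
        ring
      · simp only [lead, symm, List.map_cons, List.map_nil, List.sum_cons, List.sum_nil, hn']
        ring)
  simp only [List.map_cons, List.map_nil, List.sum_cons, List.sum_nil] at h
  linear_combination h

theorem row_pa_qA (hΩ : Ω.FiniteSlices) {n : ℤ} (hn : -1 ≤ n) :
    6 * Ω.mom (n + 1) (n + 1) 2 0 0 + (-3) * Ω.mom (n + 1) (n + 1) 1 1 0 +
        (-5 * (n : K) ^ 2 - 10 * (n : K) - 5) * Ω.mom (n + 1) (n + 1) 1 0 0 +
        1 * Ω.mom (n + 1) (n + 1) 0 2 0 + (2 * (n : K) + 2) * Ω.mom (n + 1) (n + 1) 0 0 1 +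
        ((n : K) ^ 4 + 4 * (n : K) ^ 3 + 6 * (n : K) ^ 2 + 4 * (n : K) + 1) * Ω.mom (n + 1) (n + 1)
          0 0 0 =
      (16 * (n : K) + 30) * Ω.mom n n 1 0 0 +
        (-4 * (n : K) ^ 3 - 10 * (n : K) ^ 2 - 8 * (n : K) - 6) * Ω.mom n n 0 0 0 := by
  have h := mom_row hΩ 1 0 0 1 0 (by norm_num [Small]) (m := n) (m' := n)
    (M := n + 1) (M' := n + 1) (by linarith) (by linarith) (by ring) (by ring)
    (by linarith) (by linarith) (fun p q r A B => q * A)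
    [(6, 2, 0, 0), (-3, 1, 1, 0), (-5 * (n : K) ^ 2 - 10 * (n : K) - 5, 1, 0, 0), (1, 0, 2, 0),
      (2 * (n : K) + 2, 0, 0, 1), ((n : K) ^ 4 + 4 * (n : K) ^ 3 + 6 * (n : K) ^ 2 + 4 * (n : K) +
      1, 0, 0, 0)]
    [(16 * (n : K) + 30, 1, 0, 0), (-4 * (n : K) ^ 3 - 10 * (n : K) ^ 2 - 8 * (n : K) - 6, 0, 0,
      0)]
    (by
      intro m m' hm hm' e₂ e₃ c p q r A B h
      push_cast at hm hm'
      have hn' : (n : K) = m - 1 := by linear_combination hm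
      obtain rfl : m = m' := by linear_combination hm' - hm
      refine (h.alt_mul 1 0 0 0 1 (fun _ _ _ _ _ h => h.cube_mul_cube)
        fun p q r A B h => ?_).trans (congrArg (· * vdm p q r A B) ?_)
      · simp only [upper, up]
        norm_num
        ring
      · simp only [lead, symm, List.map_cons, List.map_nil, List.sum_cons, List.sum_nil, hn']
        ring)
    (by
      intro m m' hm hm' e₂ e₃ c p q r A B h
      have hn' : (n : K) = m := by linear_combination hm
      obtain rfl : m = m' := by linear_combination hm' - hm
      refine (h.alt_mul 1 0 0 1 1 (fun _ _ _ _ _ h => h.num_mul_cube)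
        fun p q r A B h => ?_).trans (congrArg (· * vdm p q r A B) ?_)
      · simp only [lower, lo, num]
        norm_num
        ring
      · simp only [lead, symm, List.map_cons, List.map_nil, List.sum_cons, List.sum_nil, hn']
        ring)
  simp only [List.map_cons, List.map_nil, List.sum_cons, List.sum_nil] at h
  linear_combination h

theorem row_pa_pq (hΩ : Ω.FiniteSlices) {n : ℤ} (hn : -1 ≤ n) :
    3 * Ω.mom (n + 1) (n + 1) 2 0 0 + 1 * Ω.mom (n + 1) (n + 1) 1 1 0 +
        (-4 * (n : K) ^ 2 - 8 * (n : K) - 4) * Ω.mom (n + 1) (n + 1) 1 0 0 +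
        (-(n : K) ^ 2 - 2 * (n : K) - 1) * Ω.mom (n + 1) (n + 1) 0 1 0 +
        (3 * (n : K) + 3) * Ω.mom (n + 1) (n + 1) 0 0 1 +
        ((n : K) ^ 4 + 4 * (n : K) ^ 3 + 6 * (n : K) ^ 2 + 4 * (n : K) + 1) * Ω.mom (n + 1) (n + 1)
          0 0 0 =
      (12 * (n : K) + 30) * Ω.mom n n 1 0 0 + (4 * (n : K) + 6) * Ω.mom n n 0 1 0 +
        (-4 * (n : K) ^ 3 - 10 * (n : K) ^ 2 - 6 * (n : K) - 6) * Ω.mom n n 0 0 0 := by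
  have h := mom_row hΩ 1 0 0 1 0 (by norm_num [Small]) (m := n) (m' := n)
    (M := n + 1) (M' := n + 1) (by linarith) (by linarith) (by ring) (by ring)
    (by linarith) (by linarith) (fun p q r A B => p * q)
    [(3, 2, 0, 0), (1, 1, 1, 0), (-4 * (n : K) ^ 2 - 8 * (n : K) - 4, 1, 0, 0), (-(n : K) ^ 2 -
      2 * (n : K) - 1, 0, 1, 0), (3 * (n : K) + 3, 0, 0, 1), ((n : K) ^ 4 + 4 * (n : K) ^ 3 + 6 *
      (n : K) ^ 2 + 4 * (n : K) + 1, 0, 0, 0)]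
    [(12 * (n : K) + 30, 1, 0, 0), (4 * (n : K) + 6, 0, 1, 0), (-4 * (n : K) ^ 3 - 10 * (n : K)
      ^ 2 - 6 * (n : K) - 6, 0, 0, 0)]
    (by
      intro m m' hm hm' e₂ e₃ c p q r A B h
      push_cast at hm hm'
      have hn' : (n : K) = m - 1 := by linear_combination hm
      obtain rfl : m = m' := by linear_combination hm' - hm
      refine (h.alt_mul 0 1 0 1 0 (fun _ _ _ _ _ h => h.cube_mul_cube)
        fun p q r A B h => ?_).trans (congrArg (· * vdm p q r A B) ?_)
      · simp only [upper, up]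
        norm_num
        ring
      · simp only [lead, symm, List.map_cons, List.map_nil, List.sum_cons, List.sum_nil, hn']
        ring)
    (by
      intro m m' hm hm' e₂ e₃ c p q r A B h
      have hn' : (n : K) = m := by linear_combination hm
      obtain rfl : m = m' := by linear_combination hm' - hm
      refine (h.alt_mul 1 1 0 1 0 (fun _ _ _ _ _ h => h.num_mul_cube)
        fun p q r A B h => ?_).trans (congrArg (· * vdm p q r A B) ?_)
      · simp only [lower, lo, num]
        norm_num
        ring
      · simp only [lead, symm, List.map_cons, List.map_nil, List.sum_cons, List.sum_nil, hn']
        ring)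
  simp only [List.map_cons, List.map_nil, List.sum_cons, List.sum_nil] at h
  linear_combination h

theorem row_pp_pqA (hΩ : Ω.FiniteSlices) {n : ℤ} (hn : -1 ≤ n) :
    (-3) * Ω.mom n n 2 0 0 + 3 * Ω.mom n n 1 1 0 + (-3) * Ω.mom n n 1 0 1 +
        (-1) * Ω.mom n n 0 2 0 + 2 * Ω.mom n n 0 1 1 + (n : K) * Ω.mom n n 0 0 1 =
      0 := by
  have h := mom_row hΩ 1 0 (-1) 0 0 (by norm_num [Small]) (m := n) (m' := n)
    (M := n) (M' := n) (by linarith) (by linarith) (by ring) (by ring)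
    (by linarith) (by linarith) (fun p q r A B => p * q * A)
    []
    [(3, 2, 0, 0), (-3, 1, 1, 0), (3, 1, 0, 1), (1, 0, 2, 0), (-2, 0, 1, 1), (-(n : K), 0, 0,
      1)]
    (by
      intro m m' hm hm' e₂ e₃ c p q r A B h
      obtain rfl : m = m' := by linear_combination hm' - hm
      refine (h.alt_mul_rotate 0 0 0 0 0 (fun _ _ _ _ _ h => h.diag_cube)
        fun p q r A B h => ?_).trans (congrArg (· * vdm p q r A B) ?_)
      · simp only [upper, up]
        norm_num
        ring
      · simp only [lead, List.map_nil, List.sum_nil]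
        ring)
    (by
      intro m m' hm hm' e₂ e₃ c p q r A B h
      have hn' : (n : K) = m := by linear_combination hm
      obtain rfl : m = m' := by linear_combination hm' - hm
      refine (h.alt_mul 1 1 0 0 1 (fun _ _ _ _ _ h => h.diag_cube)
        fun p q r A B h => ?_).trans (congrArg (· * vdm p q r A B) ?_)
      · simp only [lower, lo, num]
        norm_num
        ring
      · simp only [lead, symm, List.map_cons, List.map_nil, List.sum_cons, List.sum_nil, hn']
        ring)
  simp only [List.map_cons, List.map_nil, List.sum_cons, List.sum_nil] at h
  linear_combination h

theorem row_pa_q_c (hΩ : Ω.FiniteSlices) {n : ℤ} (hn : -1 ≤ n) :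
    (-4 * (n : K) - 4) * Ω.mom (n + 1) (n + 1) 2 0 0 + 3 * Ω.mom (n + 1) (n + 1) 1 0 1 +
        ((n : K) ^ 3 + 3 * (n : K) ^ 2 + 3 * (n : K) + 1) * Ω.mom (n + 1) (n + 1) 1 0 0 =
      12 * Ω.mom n n 2 0 0 + (-4 * (n : K) ^ 2 - 10 * (n : K) - 24) * Ω.mom n n 1 0 0 +
        (-4 * (n : K)) * Ω.mom n n 0 0 0 := by
  have h := mom_row hΩ 1 0 0 1 0 (by norm_num [Small]) (m := n) (m' := n)
    (M := n + 1) (M' := n + 1) (by linarith) (by linarith) (by ring) (by ring)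
    (by linarith) (by linarith) (fun p q r A B => q * (A * B))
    [(-4 * (n : K) - 4, 2, 0, 0), (3, 1, 0, 1), ((n : K) ^ 3 + 3 * (n : K) ^ 2 + 3 * (n : K) +
      1, 1, 0, 0)]
    [(12, 2, 0, 0), (-4 * (n : K) ^ 2 - 10 * (n : K) - 24, 1, 0, 0), (-4 * (n : K), 0, 0, 0)]
    (by
      intro m m' hm hm' e₂ e₃ c p q r A B h
      push_cast at hm hm'
      have hn' : (n : K) = m - 1 := by linear_combination hm
      obtain rfl : m = m' := by linear_combination hm' - hm
      refine (h.alt_mul 1 0 0 c 0 (fun _ _ _ _ _ h => h.cube_mul_cube)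
        fun p q r A B h => ?_).trans (congrArg (· * vdm p q r A B) ?_)
      · simp only [upper, up]
        norm_num
        linear_combination (q - r) * ((A - q) ^ 3 * (A - r) ^ 3) * h.prod₂
      · simp only [lead, symm, List.map_cons, List.map_nil, List.sum_cons, List.sum_nil, hn']
        ring)
    (by
      intro m m' hm hm' e₂ e₃ c p q r A B h
      have hn' : (n : K) = m := by linear_combination hm
      obtain rfl : m = m' := by linear_combination hm' - hm
      refine (h.alt_mul 1 0 0 (c + m) (-1) (fun _ _ _ _ _ h => h.num_mul_cube)
        fun p q r A B h => ?_).trans (congrArg (· * vdm p q r A B) ?_)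
      · simp only [lower, lo, num]
        norm_num
        linear_combination (q - r) * ((2 * A + 1) * (2 * A + 2) * (B - p) ^ 3) * (h.prod₂ +
          h.sum₂)
      · simp only [lead, symm, List.map_cons, List.map_nil, List.sum_cons, List.sum_nil, hn']
        ring)
  simp only [List.map_cons, List.map_nil, List.sum_cons, List.sum_nil] at h
  linear_combination h

theorem row_pa_q_e (hΩ : Ω.FiniteSlices) {n : ℤ} (hn : -1 ≤ n) :
    (-4 * (n : K) - 4) * Ω.mom (n + 1) (n + 1) 1 1 0 + 3 * Ω.mom (n + 1) (n + 1) 0 1 1 +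
        ((n : K) ^ 3 + 3 * (n : K) ^ 2 + 3 * (n : K) + 1) * Ω.mom (n + 1) (n + 1) 0 1 0 =
      12 * Ω.mom n n 1 1 0 + (-18) * Ω.mom n n 1 0 0 +
        (-4 * (n : K) ^ 2 - 10 * (n : K) - 12) * Ω.mom n n 0 1 0 + (-6 * (n : K))
          * Ω.mom n n 0 0 0 := by
  have h := mom_row hΩ 1 0 0 1 0 (by norm_num [Small]) (m := n) (m' := n)
    (M := n + 1) (M' := n + 1) (by linarith) (by linarith) (by ring) (by ring)
    (by linarith) (by linarith) (fun p q r A B => q * (p * q + p * r + q * r))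
    [(-4 * (n : K) - 4, 1, 1, 0), (3, 0, 1, 1), ((n : K) ^ 3 + 3 * (n : K) ^ 2 + 3 * (n : K) +
      1, 0, 1, 0)]
    [(12, 1, 1, 0), (-18, 1, 0, 0), (-4 * (n : K) ^ 2 - 10 * (n : K) - 12, 0, 1, 0), (-6 * (n :
      K), 0, 0, 0)]
    (by
      intro m m' hm hm' e₂ e₃ c p q r A B h
      push_cast at hm hm'
      have hn' : (n : K) = m - 1 := by linear_combination hm
      obtain rfl : m = m' := by linear_combination hm' - hm
      refine (h.alt_mul e₂ 0 0 1 0 (fun _ _ _ _ _ h => h.cube_mul_cube)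
        fun p q r A B h => ?_).trans (congrArg (· * vdm p q r A B) ?_)
      · simp only [upper, up]
        norm_num
        linear_combination (q - r) * ((A - q) ^ 3 * (A - r) ^ 3) * h.pairs
      · simp only [lead, symm, List.map_cons, List.map_nil, List.sum_cons, List.sum_nil, hn']
        ring)
    (by
      intro m m' hm hm' e₂ e₃ c p q r A B h
      have hn' : (n : K) = m := by linear_combination hm
      obtain rfl : m = m' := by linear_combination hm' - hm
      refine (h.alt_mul (e₂ + m) (-1) 0 1 0 (fun _ _ _ _ _ h => h.num_mul_cube)
        fun p q r A B h => ?_).trans (congrArg (· * vdm p q r A B) ?_)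
      · simp only [lower, lo, num]
        norm_num
        linear_combination (q - r) * ((2 * A + 1) * (2 * A + 2) * (B - p) ^ 3) * (h.pairs +
          h.sum₃)
      · simp only [lead, symm, List.map_cons, List.map_nil, List.sum_cons, List.sum_nil, hn']
        ring)
  simp only [List.map_cons, List.map_nil, List.sum_cons, List.sum_nil] at h
  linear_combination h

theorem row_pa_ppq (hΩ : Ω.FiniteSlices) {n : ℤ} (hn : -1 ≤ n) :
    (3 * (n : K) + 3) * Ω.mom (n + 1) (n + 1) 2 0 0 +
        (5 * (n : K) + 5) * Ω.mom (n + 1) (n + 1) 1 1 0 + (-7) * Ω.mom (n + 1) (n + 1) 1 0 1 +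
        (-4 * (n : K) ^ 3 - 12 * (n : K) ^ 2 - 12 * (n : K) - 4) * Ω.mom (n + 1) (n + 1) 1 0 0 +
        (-2 * (n : K) ^ 3 - 6 * (n : K) ^ 2 - 6 * (n : K) - 2) * Ω.mom (n + 1) (n + 1) 0 1 0 +
        (4 * (n : K) ^ 2 + 8 * (n : K) + 4) * Ω.mom (n + 1) (n + 1) 0 0 1 +
        ((n : K) ^ 5 + 5 * (n : K) ^ 4 + 10 * (n : K) ^ 3 + 10 * (n : K) ^ 2 + 5 * (n : K) + 1)
          * Ω.mom (n + 1) (n + 1) 0 0 0 =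
      (-4) * Ω.mom n n 2 0 0 + (-12) * Ω.mom n n 1 1 0 +
        (12 * (n : K) ^ 2 + 36 * (n : K) + 50) * Ω.mom n n 1 0 0 +
        (8 * (n : K) ^ 2 + 20 * (n : K) + 18) * Ω.mom n n 0 1 0 + (-4 * (n : K) - 6)
          * Ω.mom n n 0 0 1 +
        (-4 * (n : K) ^ 4 - 14 * (n : K) ^ 3 - 18 * (n : K) ^ 2 - 6 * (n : K) - 6)
          * Ω.mom n n 0 0 0 := by
  have h := mom_row hΩ 1 0 0 1 0 (by norm_num [Small]) (m := n) (m' := n)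
    (M := n + 1) (M' := n + 1) (by linarith) (by linarith) (by ring) (by ring)
    (by linarith) (by linarith) (fun p q r A B => p ^ 2 * q)
    [(3 * (n : K) + 3, 2, 0, 0), (5 * (n : K) + 5, 1, 1, 0), (-7, 1, 0, 1), (-4 * (n : K) ^ 3 -
      12 * (n : K) ^ 2 - 12 * (n : K) - 4, 1, 0, 0), (-2 * (n : K) ^ 3 - 6 * (n : K) ^ 2 - 6 * (n
      : K) - 2, 0, 1, 0), (4 * (n : K) ^ 2 + 8 * (n : K) + 4, 0, 0, 1), ((n : K) ^ 5 + 5 * (n : K)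
      ^ 4 + 10 * (n : K) ^ 3 + 10 * (n : K) ^ 2 + 5 * (n : K) + 1, 0, 0, 0)]
    [(-4, 2, 0, 0), (-12, 1, 1, 0), (12 * (n : K) ^ 2 + 36 * (n : K) + 50, 1, 0, 0), (8 * (n :
      K) ^ 2 + 20 * (n : K) + 18, 0, 1, 0), (-4 * (n : K) - 6, 0, 0, 1), (-4 * (n : K) ^ 4 - 14 *
      (n : K) ^ 3 - 18 * (n : K) ^ 2 - 6 * (n : K) - 6, 0, 0, 0)]
    (by
      intro m m' hm hm' e₂ e₃ c p q r A B h
      push_cast at hm hm'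
      have hn' : (n : K) = m - 1 := by linear_combination hm
      obtain rfl : m = m' := by linear_combination hm' - hm
      refine (h.alt_mul 0 0 1 1 0 (fun _ _ _ _ _ h => h.cube_mul_cube)
        fun p q r A B h => ?_).trans (congrArg (· * vdm p q r A B) ?_)
      · simp only [upper, up]
        norm_num
        ring
      · simp only [lead, symm, List.map_cons, List.map_nil, List.sum_cons, List.sum_nil, hn']
        ring)
    (by
      intro m m' hm hm' e₂ e₃ c p q r A B h
      have hn' : (n : K) = m := by linear_combination hm
      obtain rfl : m = m' := by linear_combination hm' - hm
      refine (h.alt_mul 1 2 1 1 0 (fun _ _ _ _ _ h => h.num_mul_cube)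
        fun p q r A B h => ?_).trans (congrArg (· * vdm p q r A B) ?_)
      · simp only [lower, lo, num]
        norm_num
        ring
      · simp only [lead, symm, List.map_cons, List.map_nil, List.sum_cons, List.sum_nil, hn']
        ring)
  simp only [List.map_cons, List.map_nil, List.sum_cons, List.sum_nil] at h
  linear_combination h

theorem row_diag_one (hΩ : Ω.FiniteSlices) {n : ℤ} (hn : 0 ≤ n) :
    1 * Ω.mom (n + 1) (n + 1) 0 0 0 =
      16 * Ω.mom (n - 2) (n - 1) 2 0 0 + (24 * (n : K) - 4) * Ω.mom (n - 2) (n - 1) 1 0 0 +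
        (8 * (n : K) ^ 2 - 4 * (n : K)) * Ω.mom (n - 2) (n - 1) 0 0 0 := by
  have h := mom_row hΩ 1 1 1 1 1 (by norm_num [Small]) (m := n - 2) (m' := n - 1)
    (M := n + 1) (M' := n + 1) (by linarith) (by linarith) (by ring) (by ring)
    (by linarith) (by linarith) (fun p q r A B => p ^ 2 * q * A)
    [(1, 0, 0, 0)]
    [(16, 2, 0, 0), (24 * (n : K) - 4, 1, 0, 0), (8 * (n : K) ^ 2 - 4 * (n : K), 0, 0, 0)]
    (by
      intro m m' hm hm' e₂ e₃ c p q r A B h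
      push_cast at hm hm'
      obtain rfl : m = m' := by linear_combination hm' - hm
      refine (h.alt_mul (u := fun _ _ _ _ _ => 1) (a₀ := 0) (a₁ := 0) (a₂ := 0) (b₀ := 1) (b₁ := 0)
        (b₂ := 0) 0 0 1 0 1 (fun _ _ _ _ _ _ => by ring) fun p q r A B h => ?_).trans
        (congrArg (· * vdm p q r A B) ?_)
      · simp only [upper, up]
        norm_num
        ring
      · simp only [lead, symm, List.map_cons, List.map_nil, List.sum_cons, List.sum_nil]
        ring)
    (by
      intro m m' hm hm' e₂ e₃ c p q r A B h
      push_cast at hm hm'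
      have hn' : (n : K) = m + 2 := by linear_combination hm
      obtain rfl : m' = m + 1 := by linear_combination hm - hm'
      have h₁ : ∀ A B : K, A + B = m + 1 → A * B = c →
          (2 * A + 1) * (2 * B + 1) = 4 * c + 2 * m + 3 ∧ (A + 1) * (B + 1) = c + m + 2 :=
        fun A B h h' => ⟨by linear_combination 2 * h + 4 * h', by linear_combination h + h'⟩
      refine (h.alt_mul (u := fun _ _ _ _ _ => 1) (a₀ := 0) (a₁ := 0) (a₂ := 0) (b₀ := 1) (b₁ := 0)
        (b₂ := 0) 1 2 1 ((4 * c + 2 * m + 3) * (4 * (c + m + 2)))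
          ((4 * c + 2 * m + 3) * (4 * (c + m + 2))) (fun _ _ _ _ _ _ => by ring)
            fun p q r A B h => ?_).trans
        (congrArg (· * vdm p q r A B) ?_)
      · simp only [lower, lo, num]
        norm_num
        obtain ⟨h₂, h₃⟩ := h₁ A B h.sum₂ h.prod₂
        rw [← h₂, ← h₃]
        ring
      · simp only [lead, symm, List.map_cons, List.map_nil, List.sum_cons, List.sum_nil, hn']
        ring)
  simp only [List.map_cons, List.map_nil, List.sum_cons, List.sum_nil] at h
  linear_combination h

theorem row_pp_A_e_low (hΩ : Ω.FiniteSlices) {n : ℤ} (hn : 0 ≤ n) :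
    3 * Ω.mom (n - 2) (n - 1) 2 0 0 + (-3) * Ω.mom (n - 2) (n - 1) 1 1 0 +
        3 * Ω.mom (n - 2) (n - 1) 1 0 0 + 1 * Ω.mom (n - 2) (n - 1) 0 2 0 +
        (-3) * Ω.mom (n - 2) (n - 1) 0 1 0 + (-(n : K) - 1) * Ω.mom (n - 2) (n - 1) 0 0 1 +
        (-(n : K) + 2) * Ω.mom (n - 2) (n - 1) 0 0 0 =
      0 := by
  have h := mom_row hΩ 1 0 (-1) 0 0 (by norm_num [Small]) (m := n - 2) (m' := n - 1)
    (M := n - 2) (M' := n - 1) (by linarith) (by linarith) (by ring) (by ring)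
    (by linarith) (by linarith) (fun p q r A B => A * (p * q + p * r + q * r))
    []
    [(-3, 2, 0, 0), (3, 1, 1, 0), (-3, 1, 0, 0), (-1, 0, 2, 0), (3, 0, 1, 0), ((n : K) + 1, 0,
      0, 1), ((n : K) - 2, 0, 0, 0)]
    (by
      intro m m' hm hm' e₂ e₃ c p q r A B h
      push_cast at hm hm'
      obtain rfl : m' = m + 1 := by linear_combination hm - hm'
      refine (h.alt_mul_rotate 0 0 0 0 0 (fun _ _ _ _ _ h => h.diag_cube_succ)
        fun p q r A B h => ?_).trans (congrArg (· * vdm p q r A B) ?_)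
      · simp only [upper, up]
        norm_num
        ring
      · simp only [lead, List.map_nil, List.sum_nil]
        ring)
    (by
      intro m m' hm hm' e₂ e₃ c p q r A B h
      push_cast at hm hm'
      have hn' : (n : K) = m + 2 := by linear_combination hm
      obtain rfl : m' = m + 1 := by linear_combination hm - hm'
      refine (h.alt_mul 1 0 0 0 (-1) (fun _ _ _ _ _ h => h.diag_cube_succ)
        fun p q r A B h => ?_).trans (congrArg (· * vdm p q r A B) ?_)
      · simp only [lower, lo, num]
        norm_num
        ring
      · simp only [lead, symm, List.map_cons, List.map_nil, List.sum_cons, List.sum_nil, hn']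
        ring)
  simp only [List.map_cons, List.map_nil, List.sum_cons, List.sum_nil] at h
  linear_combination h

theorem row_ppa_q (hΩ : Ω.FiniteSlices) {n : ℤ} (hn : 0 ≤ n) :
    (-3) * Ω.mom n n 0 0 0 =
      (-8 * (n : K) + 4) * Ω.mom (n - 2) (n - 1) 2 0 0 +
        (12 * (n : K) - 6) * Ω.mom (n - 2) (n - 1) 1 1 0 + (-12) * Ω.mom (n - 2) (n - 1) 1 0 1 +
        (6 * (n : K) ^ 2 - 8 * (n : K) + 4) * Ω.mom (n - 2) (n - 1) 1 0 0 +
        (-4 * (n : K) - 2) * Ω.mom (n - 2) (n - 1) 0 2 0 + 6 * Ω.mom (n - 2) (n - 1) 0 1 0 +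
        (4 * (n : K) ^ 2 - 6 * (n : K) + 2) * Ω.mom (n - 2) (n - 1) 0 0 1 +
        (2 * (n : K) ^ 3 - 2 * (n : K) ^ 2 + 4 * (n : K) - 4) * Ω.mom (n - 2) (n - 1) 0 0 0 := by
  have h := mom_row hΩ 1 1 0 1 0 (by norm_num [Small]) (m := n - 2) (m' := n - 1)
    (M := n) (M' := n) (by linarith) (by linarith) (by ring) (by ring)
    (by linarith) (by linarith) (fun p q r A B => q)
    [(-3, 0, 0, 0)]
    [(-8 * (n : K) + 4, 2, 0, 0), (12 * (n : K) - 6, 1, 1, 0), (-12, 1, 0, 1), (6 * (n : K) ^ 2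
      - 8 * (n : K) + 4, 1, 0, 0), (-4 * (n : K) - 2, 0, 2, 0), (6, 0, 1, 0), (4 * (n : K) ^ 2 - 6
      * (n : K) + 2, 0, 0, 1), (2 * (n : K) ^ 3 - 2 * (n : K) ^ 2 + 4 * (n : K) - 4, 0, 0, 0)]
    (by
      intro m m' hm hm' e₂ e₃ c p q r A B h
      obtain rfl : m = m' := by linear_combination hm' - hm
      refine (h.alt_mul_rotate (-1) 0 0 1 0 (fun _ _ _ _ _ h => h.sub_cube)
        fun p q r A B h => ?_).trans (congrArg (· * vdm p q r A B) ?_)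
      · simp only [upper, up]
        norm_num
        ring
      · simp only [lead, symm, List.map_cons, List.map_nil, List.sum_cons, List.sum_nil]
        ring)
    (by
      intro m m' hm hm' e₂ e₃ c p q r A B h
      push_cast at hm hm'
      have hn' : (n : K) = m + 2 := by linear_combination hm
      obtain rfl : m' = m + 1 := by linear_combination hm - hm'
      refine (h.alt_mul_rotate (-1) 0 0 (-4 * c + 2) (4 * m + 10)
        (fun _ _ _ _ _ h => h.swap_cube_mul_cube_succ)
        fun p q r A B h => ?_).trans (congrArg (· * vdm p q r A B) ?_)
      · simp only [lower, lo, num]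
        norm_num
        linear_combination -(q - r) * ((B - q) ^ 3 * (B - r) ^ 3) * 4 * h.sq
      · simp only [lead, symm, List.map_cons, List.map_nil, List.sum_cons, List.sum_nil, hn']
        ring)
  simp only [List.map_cons, List.map_nil, List.sum_cons, List.sum_nil] at h
  linear_combination h

theorem row_diag_c (hΩ : Ω.FiniteSlices) {n : ℤ} (hn : 0 ≤ n) :
    1 * Ω.mom (n + 1) (n + 1) 1 0 0 =
      16 * Ω.mom (n - 2) (n - 1) 3 0 0 + (40 * (n : K) - 4) * Ω.mom (n - 2) (n - 1) 2 0 0 +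
        (32 * (n : K) ^ 2 - 8 * (n : K)) * Ω.mom (n - 2) (n - 1) 1 0 0 +
        (8 * (n : K) ^ 3 - 4 * (n : K) ^ 2) * Ω.mom (n - 2) (n - 1) 0 0 0 := by
  have h := mom_row hΩ 1 1 1 1 1 (by norm_num [Small]) (m := n - 2) (m' := n - 1)
    (M := n + 1) (M' := n + 1) (by linarith) (by linarith) (by ring) (by ring)
    (by linarith) (by linarith) (fun p q r A B => p ^ 2 * q * A * (A * B))
    [(1, 1, 0, 0)]
    [(16, 3, 0, 0), (40 * (n : K) - 4, 2, 0, 0), (32 * (n : K) ^ 2 - 8 * (n : K), 1, 0, 0), (8 *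
      (n : K) ^ 3 - 4 * (n : K) ^ 2, 0, 0, 0)]
    (by
      intro m m' hm hm' e₂ e₃ c p q r A B h
      push_cast at hm hm'
      obtain rfl : m = m' := by linear_combination hm' - hm
      refine (h.alt_mul (u := fun _ _ _ _ _ => 1) (a₀ := 0) (a₁ := 0) (a₂ := 0) (b₀ := 1) (b₁ := 0)
        (b₂ := 0) 0 0 1 0 c (fun _ _ _ _ _ _ => by ring) fun p q r A B h => ?_).trans
        (congrArg (· * vdm p q r A B) ?_)
      · simp only [upper, up]
        norm_num
        linear_combination (q - r) * p ^ 2 * A * h.prod₂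
      · simp only [lead, symm, List.map_cons, List.map_nil, List.sum_cons, List.sum_nil]
        ring)
    (by
      intro m m' hm hm' e₂ e₃ c p q r A B h
      push_cast at hm hm'
      have hn' : (n : K) = m + 2 := by linear_combination hm
      obtain rfl : m' = m + 1 := by linear_combination hm - hm'
      have h₁ : ∀ A B : K, A + B = m + 1 → A * B = c →
          (2 * A + 1) * (2 * B + 1) = 4 * c + 2 * m + 3 ∧ (A + 1) * (B + 1) = c + m + 2 :=
        fun A B h h' => ⟨by linear_combination 2 * h + 4 * h', by linear_combination h + h'⟩
      refine (h.alt_mul (u := fun _ _ _ _ _ => 1) (a₀ := 0) (a₁ := 0) (a₂ := 0) (b₀ := 1) (b₁ := 0)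
        (b₂ := 0) 1 2 1 ((4 * c + 2 * m + 3) * (4 * (c + m + 2)) * (c + m + 2))
          ((4 * c + 2 * m + 3) * (4 * (c + m + 2)) * (c + m + 2)) (fun _ _ _ _ _ _ => by ring)
            fun p q r A B h => ?_).trans
        (congrArg (· * vdm p q r A B) ?_)
      · simp only [lower, lo, num]
        norm_num
        obtain ⟨h₂, h₃⟩ := h₁ A B h.sum₂ h.prod₂
        rw [← h₂, ← h₃]
        ring
      · simp only [lead, symm, List.map_cons, List.map_nil, List.sum_cons, List.sum_nil, hn']
        ring)
  simp only [List.map_cons, List.map_nil, List.sum_cons, List.sum_nil] at h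
  linear_combination h

theorem row_pp_qA_c_low (hΩ : Ω.FiniteSlices) {n : ℤ} (hn : 0 ≤ n) :
    (-6) * Ω.mom (n - 2) (n - 1) 3 0 0 + 6 * Ω.mom (n - 2) (n - 1) 2 1 0 +
        (-6) * Ω.mom (n - 2) (n - 1) 2 0 0 + (-2) * Ω.mom (n - 2) (n - 1) 1 2 0 +
        6 * Ω.mom (n - 2) (n - 1) 1 1 0 + (2 * (n : K) + 2) * Ω.mom (n - 2) (n - 1) 1 0 1 +
        (2 * (n : K) - 4) * Ω.mom (n - 2) (n - 1) 1 0 0 =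
      0 := by
  have h := mom_row hΩ 1 0 (-1) 0 0 (by norm_num [Small]) (m := n - 2) (m' := n - 1)
    (M := n - 2) (M' := n - 1) (by linarith) (by linarith) (by ring) (by ring)
    (by linarith) (by linarith) (fun p q r A B => q * A * (A * B))
    [(-3, 3, 0, 0), (3, 2, 1, 0), (-3, 2, 0, 0), (-1, 1, 2, 0), (3, 1, 1, 0), ((n : K) + 1, 1,
      0, 1), ((n : K) - 2, 1, 0, 0)]
    [(3, 3, 0, 0), (-3, 2, 1, 0), (3, 2, 0, 0), (1, 1, 2, 0), (-3, 1, 1, 0), (-(n : K) - 1, 1,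
      0, 1), (-(n : K) + 2, 1, 0, 0)]
    (by
      intro m m' hm hm' e₂ e₃ c p q r A B h
      push_cast at hm hm'
      have hn' : (n : K) = m + 2 := by linear_combination hm
      obtain rfl : m' = m + 1 := by linear_combination hm - hm'
      refine (h.alt_mul_rotate 1 0 0 0 (-c) (fun _ _ _ _ _ h => h.diag_cube_succ)
        fun p q r A B h => ?_).trans (congrArg (· * vdm p q r A B) ?_)
      · simp only [upper, up]
        norm_num
        linear_combination -(q - r) * A * ((A - p) ^ 3 * (B - p) ^ 3) * h.prod₂
      · simp only [lead, symm, List.map_cons, List.map_nil, List.sum_cons, List.sum_nil, hn']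
        ring)
    (by
      intro m m' hm hm' e₂ e₃ c p q r A B h
      push_cast at hm hm'
      have hn' : (n : K) = m + 2 := by linear_combination hm
      obtain rfl : m' = m + 1 := by linear_combination hm - hm'
      refine (h.alt_mul 1 0 0 0 c (fun _ _ _ _ _ h => h.diag_cube_succ)
        fun p q r A B h => ?_).trans (congrArg (· * vdm p q r A B) ?_)
      · simp only [lower, lo, num]
        norm_num
        linear_combination (q - r) * A * ((A - p) ^ 3 * (B - p) ^ 3) * h.prod₂
      · simp only [lead, symm, List.map_cons, List.map_nil, List.sum_cons, List.sum_nil, hn']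
        ring)
  simp only [List.map_cons, List.map_nil, List.sum_cons, List.sum_nil] at h
  linear_combination h

theorem row_ppa_qA (hΩ : Ω.FiniteSlices) {n : ℤ} (hn : 0 ≤ n) :
    (-2 * (n : K)) * Ω.mom n n 0 0 0 =
      24 * Ω.mom (n - 2) (n - 1) 3 0 0 + (-12) * Ω.mom (n - 2) (n - 1) 2 1 0 +
        (-12 * (n : K) ^ 2 + 28 * (n : K) + 4) * Ω.mom (n - 2) (n - 1) 2 0 0 +
        4 * Ω.mom (n - 2) (n - 1) 1 2 0 +
        (12 * (n : K) ^ 2 - 6 * (n : K) - 12) * Ω.mom (n - 2) (n - 1) 1 1 0 +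
        (-16 * (n : K) - 10) * Ω.mom (n - 2) (n - 1) 1 0 1 +
        (8 * (n : K) ^ 2 - 8 * (n : K) + 8) * Ω.mom (n - 2) (n - 1) 1 0 0 +
        (-4 * (n : K) ^ 2 - 2 * (n : K) - 2) * Ω.mom (n - 2) (n - 1) 0 2 0 +
        6 * Ω.mom (n - 2) (n - 1) 0 1 0 +
        (4 * (n : K) ^ 3 - 6 * (n : K) ^ 2 - 2 * (n : K) + 2) * Ω.mom (n - 2) (n - 1) 0 0 1 +
        (2 * (n : K) ^ 3 - 2 * (n : K) ^ 2 + 4 * (n : K) - 4) * Ω.mom (n - 2) (n - 1) 0 0 0 := by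
  have h := mom_row hΩ 1 1 0 1 0 (by norm_num [Small]) (m := n - 2) (m' := n - 1)
    (M := n) (M' := n) (by linarith) (by linarith) (by ring) (by ring)
    (by linarith) (by linarith) (fun p q r A B => q * A)
    [(-2 * (n : K), 0, 0, 0)]
    [(24, 3, 0, 0), (-12, 2, 1, 0), (-12 * (n : K) ^ 2 + 28 * (n : K) + 4, 2, 0, 0), (4, 1, 2,
      0), (12 * (n : K) ^ 2 - 6 * (n : K) - 12, 1, 1, 0), (-16 * (n : K) - 10, 1, 0, 1), (8 * (n :
      K) ^ 2 - 8 * (n : K) + 8, 1, 0, 0), (-4 * (n : K) ^ 2 - 2 * (n : K) - 2, 0, 2, 0), (6, 0, 1,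
      0), (4 * (n : K) ^ 3 - 6 * (n : K) ^ 2 - 2 * (n : K) + 2, 0, 0, 1), (2 * (n : K) ^ 3 - 2 *
      (n : K) ^ 2 + 4 * (n : K) - 4, 0, 0, 0)]
    (by
      intro m m' hm hm' e₂ e₃ c p q r A B h
      have hn' : (n : K) = m := by linear_combination hm
      obtain rfl : m = m' := by linear_combination hm' - hm
      refine (h.alt_mul_rotate (-1) 0 0 0 1 (fun _ _ _ _ _ h => h.sub_cube)
        fun p q r A B h => ?_).trans (congrArg (· * vdm p q r A B) ?_)
      · simp only [upper, up]
        norm_num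
        ring
      · simp only [lead, symm, List.map_cons, List.map_nil, List.sum_cons, List.sum_nil, hn']
        ring)
    (by
      intro m m' hm hm' e₂ e₃ c p q r A B h
      push_cast at hm hm'
      have hn' : (n : K) = m + 2 := by linear_combination hm
      obtain rfl : m' = m + 1 := by linear_combination hm - hm'
      refine (h.alt_mul_rotate (-1) 0 0 (-4 * m * c - 14 * c + 2) (4 * m ^ 2 + 18 * m - 4 * c + 22)
        (fun _ _ _ _ _ h => h.swap_cube_mul_cube_succ)
        fun p q r A B h => ?_).trans (congrArg (· * vdm p q r A B) ?_)
      · simp only [lower, lo, num]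
        norm_num
        linear_combination -(q - r) * ((B - q) ^ 3 * (B - r) ^ 3) * (4 * A + 4 * m + 14) * h.sq
      · simp only [lead, symm, List.map_cons, List.map_nil, List.sum_cons, List.sum_nil, hn']
        ring)
  simp only [List.map_cons, List.map_nil, List.sum_cons, List.sum_nil] at h
  linear_combination h


/-- The second-order relation between the first moments. -/
theorem mom_pairs (hΩ : Ω.FiniteSlices) {n : ℤ} (hn : 0 ≤ n) :
    3 * Ω.mom (n + 1) (n + 1) 1 0 0 =
      ((n : K) + 1) ^ 2 * Ω.mom (n + 1) (n + 1) 0 0 0 + (4 * (n : K) + 6) * Ω.mom n n 0 0 0 := by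
  linear_combination -4 * row_ppa_qA hΩ hn + 3 * row_diag_c hΩ hn -
    ((n : K) + 1) ^ 2 * row_diag_one hΩ hn + 8 * row_pp_qA_c_low hΩ hn +
    (2 + 4 * (n : K)) * row_ppa_q hΩ hn + (4 - 8 * (n : K)) * row_pp_A_e_low hΩ hn

theorem mom_fifth (hΩ : Ω.FiniteSlices) {n : ℤ} (hn : 0 ≤ n) :
    6 * ((n : K) + 1) ^ 5 * Ω.mom (n + 1) (n + 1) 0 0 0 -
      19 * ((n : K) + 1) ^ 3 * Ω.mom (n + 1) (n + 1) 1 0 0 +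
      (48 * (n : K) ^ 4 + 120 * (n : K) ^ 3 + 176 * (n : K) ^ 2 + 128 * (n : K) + 36) *
        Ω.mom n n 0 0 0 - (112 * (n : K) ^ 2 + 106 * (n : K) + 36) * Ω.mom n n 1 0 0 +
      (96 * (n : K) ^ 3 + 96 * (n : K) ^ 2 + 168 * (n : K)) * Ω.mom (n - 1) (n - 1) 0 0 0 +
      (72 - 144 * (n : K)) * Ω.mom (n - 1) (n - 1) 1 0 0 = 0 := by
  have hn' : -1 ≤ n := by linarith
  have h := row_pp_A_e hΩ (n := n + 1) (by linarith)
  have h' := row_pp_pqA hΩ (n := n + 1) (by linarith)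
  have k := row_pa_q hΩ (n := n - 1) (by linarith)
  have k' := row_pa_qA hΩ (n := n - 1) (by linarith)
  push_cast [sub_add_cancel] at h h' k k'
  linear_combination -18 * row_pa_ppq hΩ hn' + (47 + 20 * (n : K)) * h -
    15 * row_pa_q_c hΩ hn' + 26 * ((n : K) + 1) ^ 2 * row_pa_q hΩ hn' -
    20 * ((n : K) + 1) * row_pa_qA hΩ hn' + (36 + 60 * (n : K)) * k - 36 * k' +
    18 * ((n : K) + 1) * row_pa_pq hΩ hn' - 18 * row_pa_q_e hΩ hn' + 27 * h' +
    36 * row_pp_A_e hΩ hn'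

end Weight

section Specialization

open MvPowerSeries

theorem Cc_intCast (m : ℤ) : Cc (m : ℚ) = (m : R) := map_intCast _ m

theorem prod_Icc_insert_right {a b : ℤ} (h : a ≤ b + 1) (f : ℤ → R) :
    ∏ m ∈ Finset.Icc a (b + 1), f m = f (b + 1) * ∏ m ∈ Finset.Icc a b, f m := by
  rw [← Finset.prod_insert (by simp)]
  congr 1
  ext m
  simp only [Finset.mem_Icc, Finset.mem_insert]
  omega

theorem prod_Icc_insert_left {a b : ℤ} (h : a ≤ b) (f : ℤ → R) :
    ∏ m ∈ Finset.Icc a b, f m = f a * ∏ m ∈ Finset.Icc (a + 1) b, f m := by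
  rw [← Finset.prod_insert (by simp)]
  congr 1
  ext m
  simp only [Finset.mem_Icc, Finset.mem_insert]
  omega

theorem constantCoeff_prod_ne_zero {y : R} (hy : constantCoeff y = 0) {s : Finset ℤ}
    (hs : 0 ∉ s) : constantCoeff (∏ m ∈ s, (y + Cc (m : ℚ))) ≠ 0 := by
  rw [map_prod, Finset.prod_ne_zero_iff]
  intro m hm
  have : m ≠ 0 := fun h => hs (h ▸ hm)
  simpa [Cc, hy] using this

theorem Phi_step {y : R} (hy : constantCoeff y = 0) (e : ℤ) :
    Phi e y = (y + (e : R) + 1) * Phi (e + 1) y := by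
  have key : y + Cc ((e + 1 : ℤ) : ℚ) = y + (e : R) + 1 := by
    rw [Cc_intCast]
    push_cast
    ring
  rcases lt_trichotomy e (-1) with h | rfl | h
  · rw [Phi, Phi, if_neg (by omega), if_neg (by omega), prod_Icc_insert_left (by omega), key]
  · simp [Phi, Cc]
  · rw [Phi, Phi, if_pos (by omega), if_pos (by omega), prod_Icc_insert_right (by omega), key,
      MvPowerSeries.mul_inv_rev, mul_left_comm, MvPowerSeries.mul_inv_cancel, mul_one]
    have : (e : ℚ) + 1 ≠ 0 := by exact_mod_cast (by omega : e + 1 ≠ 0)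
    simpa [hy] using this

theorem dvd_Phi {e : ℤ} (he : e < 0) (y : R) : y ∣ Phi e y := by
  rw [Phi, if_neg (by omega)]
  have := Finset.dvd_prod_of_mem (fun m : ℤ => y + Cc (m : ℚ))
    (show (0 : ℤ) ∈ Finset.Icc (e + 1) 0 by simp; omega)
  simpa [Cc] using this

/-- The inverse of the `Γ`-type factor `Φ`, multiplied by `y`; it extends the products
`y (y + 1) ⋯ (y + e)` to all integers `e`. -/
def Num (e : ℤ) (y : R) : R :=
  if 0 ≤ e then y * ∏ m ∈ Finset.Icc (1 : ℤ) e, (y + Cc (m : ℚ))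
  else (∏ m ∈ Finset.Icc (e + 1) (-1 : ℤ), (y + Cc (m : ℚ)))⁻¹

theorem Num_step {y : R} (hy : constantCoeff y = 0) (e : ℤ) :
    Num (e + 1) y = (y + (e : R) + 1) * Num e y := by
  have key : y + Cc ((e + 1 : ℤ) : ℚ) = y + (e : R) + 1 := by
    rw [Cc_intCast]
    push_cast
    ring
  rcases lt_trichotomy e (-1) with h | rfl | h
  · rw [Num, Num, if_neg (by omega), if_neg (by omega), prod_Icc_insert_left (a := e + 1)
      (by omega), key,
      MvPowerSeries.mul_inv_rev, mul_left_comm, MvPowerSeries.mul_inv_cancel, mul_one]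
    have : (e : ℚ) + 1 ≠ 0 := by exact_mod_cast (by omega : e + 1 ≠ 0)
    simpa [hy] using this
  · simp [Num]
  · rw [Num, Num, if_pos (by omega), if_pos (by omega), prod_Icc_insert_right (by omega), key]
    ring

theorem dvd_Num {e : ℤ} (he : 0 ≤ e) (y : R) : y ∣ Num e y := by
  rw [Num, if_pos he]
  exact dvd_mul_right _ _

/-- The classes `Pᵢ`. -/
def cP : Fin 3 → R := ![x21 + x32, x11 + x32, x11 + x21 + x32 - x31]

/-- The classes `Xⱼ`. -/
def cX : Fin 2 → R := ![x11 + x21 + x32, x11 + x21 - x31 + 2 * x32]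

theorem constantCoeff_cP (i : Fin 3) : constantCoeff (cP i) = 0 := by
  fin_cases i <;> simp [cP, x11, x21, x31, x32]

theorem constantCoeff_cX (j : Fin 2) : constantCoeff (cX j) = 0 := by
  fin_cases j <;> simp [cX, x11, x21, x31, x32]

/-- The hypergeometric weight attached to a specialisation of the classes. -/
def weight {K : Type*} [CommRing K] (L : R →+* K) (hL : L D2 = 0) : Weight K where
  P i := L (cP i)
  X j := L (cX j)
  φ i j e := L (Phi e (cX j - cP i))
  N j A := L (Num (2 * A) (2 * cX j))
  P_sum := by
    rw [← map_add, ← map_add, ← hL]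
    congr 1
    simp [cP, D2, x12, x22]
    ring
  X_sum := by
    rw [← map_add, ← hL]
    congr 1
    simp [cX, D2, x12, x22]
    ring
  φ_step i j e := by
    rw [Phi_step (by simp [constantCoeff_cX, constantCoeff_cP])]
    simp
  N_step j A := by
    have h : constantCoeff (2 * cX j) = 0 := by simp [constantCoeff_cX]
    have h2 : L 2 = 2 := map_ofNat L 2
    rw [show 2 * (A + 1) = 2 * A + 1 + 1 by ring, Num_step h, Num_step h]
    simp [h2]
    ring

namespace Weight
variable {K : Type*} [CommRing K] (Ω : Weight K)

theorem val_eq_prod (p : Fin 3 → ℤ) (A : Fin 2 → ℤ) : Ω.val (p 0) (p 1) (p 2) (A 0) (A 1) =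
    (∏ k, Ω.N k (A k)) * ∏ x : Fin 3 × Fin 2, Ω.φ x.1 x.2 (A x.2 - p x.1) ^ 3 := by
  simp only [val, Fintype.prod_prod_type, Fin.prod_univ_two, Fin.prod_univ_three]
  ring

end Weight

section Nilpotent
variable {K : Type*} [CommRing K] {L : R →+* K} (hL : L D2 = 0) {τ : K}

theorem dvd_weight_φ (hLτ : ∀ y, constantCoeff y = 0 → τ ∣ L y) (i : Fin 3) (j : Fin 2) {e : ℤ}
    (he : e < 0) : τ ∣ (weight L hL).φ i j e :=
  (hLτ _ (by simp [constantCoeff_cX, constantCoeff_cP])).trans (map_dvd L (dvd_Phi he _))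

theorem dvd_weight_N (hLτ : ∀ y, constantCoeff y = 0 → τ ∣ L y) (j : Fin 2) {A : ℤ}
    (hA : 0 ≤ A) : τ ∣ (weight L hL).N j A :=
  (hLτ _ (by simp [constantCoeff_cX])).trans (map_dvd L (dvd_Num (by omega) _))

theorem weight_val_eq_zero (hτ : τ ^ 7 = 0) (hLτ : ∀ y, constantCoeff y = 0 → τ ∣ L y)
    (p : Fin 3 → ℤ) (A : Fin 2 → ℤ) {a b : Fin 3 × Fin 2} (hab : a ≠ b) (ha : A a.2 < p a.1)
    (hb : A b.2 < p b.1) {k : Fin 2} (hk : 0 ≤ A k) :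
    (weight L hL).val (p 0) (p 1) (p 2) (A 0) (A 1) = 0 := by
  refine zero_dvd_iff.mp ?_
  rw [← hτ, Weight.val_eq_prod, show τ ^ 7 = τ * (τ ^ 3 * τ ^ 3) by ring]
  refine mul_dvd_mul ((dvd_weight_N hL hLτ k hk).trans
    (Finset.dvd_prod_of_mem _ (Finset.mem_univ k))) ?_
  refine dvd_trans ?_ (Finset.prod_dvd_prod_of_subset {a, b} _ _ (Finset.subset_univ _))
  rw [Finset.prod_pair hab]
  exact mul_dvd_mul (pow_dvd_pow_of_dvd (dvd_weight_φ hL hLτ _ _ (by omega)) 3)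
    (pow_dvd_pow_of_dvd (dvd_weight_φ hL hLτ _ _ (by omega)) 3)

/-- At a lattice point of the support of the weight at most one of the `Aⱼ - pᵢ` is negative. -/
theorem nonneg_of_slice_ne_zero (hτ : τ ^ 7 = 0) (hLτ : ∀ y, constantCoeff y = 0 → τ ∣ L y)
    {m m' : ℤ} (hm' : -1 ≤ m') {z : ℤ × ℤ × ℤ} (hz : (weight L hL).slice m m' z ≠ 0)
    {a b : Fin 3 × Fin 2} (hab : a ≠ b) :
    ![z.1, z.2.1, m - z.1 - z.2.1] a.1 ≤ ![z.2.2, m' - z.2.2] a.2 ∨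
      ![z.1, z.2.1, m - z.1 - z.2.1] b.1 ≤ ![z.2.2, m' - z.2.2] b.2 := by
  by_contra! h
  have hk : ∃ k : Fin 2, 0 ≤ ![z.2.2, m' - z.2.2] k := by
    rcases le_or_gt 0 z.2.2 with h | h
    · exact ⟨0, h⟩
    · exact ⟨1, by simp; omega⟩
  obtain ⟨k, hk⟩ := hk
  exact hz (weight_val_eq_zero hL hτ hLτ _ _ hab h.1 h.2 hk)

/-- A bound for the support of the weight. -/
theorem mem_box_of_slice_ne_zero (hτ : τ ^ 7 = 0) (hLτ : ∀ y, constantCoeff y = 0 → τ ∣ L y)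
    {m m' : ℤ} (hm' : -1 ≤ m') {z : ℤ × ℤ × ℤ}
    (hz : (weight L hL).slice m m' z ≠ 0) :
    (z.1 ≤ z.2.2 ∨ z.2.1 ≤ z.2.2) ∧ (z.1 ≤ z.2.2 ∨ m - z.1 - z.2.1 ≤ z.2.2) ∧
    (z.2.1 ≤ z.2.2 ∨ m - z.1 - z.2.1 ≤ z.2.2) ∧
    (z.1 ≤ m' - z.2.2 ∨ z.2.1 ≤ m' - z.2.2) ∧
    (z.1 ≤ m' - z.2.2 ∨ m - z.1 - z.2.1 ≤ m' - z.2.2) ∧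
    (z.2.1 ≤ m' - z.2.2 ∨ m - z.1 - z.2.1 ≤ m' - z.2.2) ∧
    (z.1 ≤ z.2.2 ∨ z.1 ≤ m' - z.2.2) ∧ (z.2.1 ≤ z.2.2 ∨ z.2.1 ≤ m' - z.2.2) ∧
    (m - z.1 - z.2.1 ≤ z.2.2 ∨ m - z.1 - z.2.1 ≤ m' - z.2.2) := by
  have h := fun a b hab => nonneg_of_slice_ne_zero hL hτ hLτ hm' hz (a := a) (b := b) hab
  exact ⟨h (0, 0) (1, 0) (by decide), h (0, 0) (2, 0) (by decide), h (1, 0) (2, 0) (by decide),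
    h (0, 1) (1, 1) (by decide), h (0, 1) (2, 1) (by decide), h (1, 1) (2, 1) (by decide),
    h (0, 0) (0, 1) (by decide), h (1, 0) (1, 1) (by decide), h (2, 0) (2, 1) (by decide)⟩

theorem finiteSlices (hτ : τ ^ 7 = 0) (hLτ : ∀ y, constantCoeff y = 0 → τ ∣ L y) :
    (weight L hL).FiniteSlices := by
  intro m m' hm hm'
  refine ((Set.finite_Icc (-(4 * m + 4 * m' + 20)) (4 * m + 4 * m' + 20)).prod
    ((Set.finite_Icc (-(4 * m + 4 * m' + 20)) (4 * m + 4 * m' + 20)).prod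
    (Set.finite_Icc (-(4 * m + 4 * m' + 20)) (4 * m + 4 * m' + 20)))).subset ?_
  rintro ⟨a, b, c⟩ hz
  have h := mem_box_of_slice_ne_zero hL hτ hLτ hm' hz
  simp only [Set.mem_prod, Set.mem_Icc] at h ⊢
  omega

/-- On the slices relevant for the quantum period the support of the weight is effective. -/
theorem effective_of_slice_ne_zero (hτ : τ ^ 7 = 0)
    (hLτ : ∀ y, constantCoeff y = 0 → τ ∣ L y) {n : ℤ} (hn : -1 ≤ n) {a b c : ℤ}
    (hz : (weight L hL).slice n n (a, b, c) ≠ 0) :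
    0 ≤ a ∧ 0 ≤ b ∧ 0 ≤ n - a - b ∧ 0 ≤ c ∧ 0 ≤ n - c := by
  have h := mem_box_of_slice_ne_zero hL hτ hLτ hn hz
  simp only at h
  omega

end Nilpotent

/-- The effective lattice points of a slice, in the coordinates `(p₁, p₂, A₁)`. -/
def effective (n : ℤ) : Set (ℤ × ℤ × ℤ) :=
  {z | 0 ≤ z.1 ∧ 0 ≤ z.2.1 ∧ 0 ≤ n - z.1 - z.2.1 ∧ 0 ≤ z.2.2 ∧ 0 ≤ n - z.2.2}

/-- The curve class of a lattice point: `dᵢⱼ = Aⱼ - pᵢ`. -/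
def curveClass (n : ℤ) (z : ℤ × ℤ × ℤ) : Fin 6 → ℤ :=
  ![z.2.2 - z.1, n - z.2.2 - z.1, z.2.2 - z.2.1, n - z.2.2 - z.2.1,
    z.2.2 - (n - z.1 - z.2.1), n - z.2.2 - (n - z.1 - z.2.1)]

theorem deg_eq (d : Fin 6 → ℤ) : deg d = d 0 + d 1 + d 2 + d 3 + d 4 + d 5 := by
  simp [deg, Fin.sum_univ_succ]
  ring

theorem finite_effective (n : ℤ) : (effective n).Finite := by
  refine ((Set.finite_Icc 0 n).prod ((Set.finite_Icc 0 n).prod (Set.finite_Icc 0 n))).subset ?_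
  rintro ⟨a, b, c⟩ ⟨h₁, h₂, h₃, h₄, h₅⟩
  simp only [Set.mem_prod, Set.mem_Icc] at *
  omega

theorem bijOn_curveClass (n : ℤ) :
    Set.BijOn (curveClass n) (effective n) {d | d ∈ NE ∧ deg d = n} := by
  refine ⟨?_, ?_, ?_⟩
  · rintro ⟨a, b, c⟩ ⟨h₁, h₂, h₃, h₄, h₅⟩
    simp only [NE, Set.mem_ofPred_eq, deg_eq, curveClass, Fin.isValue, Matrix.cons_val] at *
    omega
  · rintro ⟨a, b, c⟩ - ⟨a', b', c'⟩ - h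
    have h₀ := congrFun h 0
    have h₁ := congrFun h 1
    have h₂ := congrFun h 2
    simp only [curveClass, Fin.isValue, Matrix.cons_val] at h₀ h₁ h₂
    simp only [Prod.mk.injEq]
    omega
  · rintro d ⟨⟨h₁, h₂, h₃, h₄, h₅, h₆, h₇⟩, h⟩
    rw [deg_eq] at h
    refine ⟨(d 2 + d 5, d 4 + d 1, d 0 + d 3 + d 4), ?_, ?_⟩
    · simp only [effective, Set.mem_ofPred_eq]
      omega
    · funext i
      fin_cases i <;>
        simp only [curveClass, Fin.isValue, Matrix.cons_val, Fin.zero_eta, Fin.mk_one,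
          Fin.reduceFinMk] <;> omega

theorem e1_curveClass (n a b c : ℤ) : e1 (curveClass n (a, b, c)) = 2 * c := by
  simp only [e1, curveClass, Fin.isValue, Matrix.cons_val]
  ring

theorem e2_curveClass (n a b c : ℤ) : e2 (curveClass n (a, b, c)) = n := by
  simp only [e2, deg_eq, curveClass, Fin.isValue, Matrix.cons_val]
  ring

theorem e3_curveClass (n a b c : ℤ) : e3 (curveClass n (a, b, c)) = 2 * (n - c) := by
  simp only [e3, curveClass, Fin.isValue, Matrix.cons_val]
  ring

theorem finite_effective_classes (n : ℤ) : {d | d ∈ NE ∧ deg d = n}.Finite :=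
  (bijOn_curveClass n).image_eq ▸ (finite_effective n).image _

section Moment
variable {K : Type*} [CommRing K] {L : R →+* K} (hL : L D2 = 0)

theorem map_prod_D2 (hL : L D2 = 0) (n : ℕ) :
    L (∏ m ∈ Finset.Icc (1 : ℤ) n, (D2 + Cc (m : ℚ))) = n.factorial := by
  induction n with
  | zero => simp
  | succ n ih =>
    rw [Nat.cast_succ, prod_Icc_insert_right (by omega), map_mul, ih, Cc_intCast, map_add, hL,
      Nat.factorial_succ]
    simp

theorem map_T_curveClass (n : ℕ) {z : ℤ × ℤ × ℤ} (hz : z ∈ effective n) :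
    n.factorial * ((weight L hL).evalAt n n z (Weight.mono (0, 0, 0)) * (weight L hL).slice n n z) =
      L (D1 * D3 * T (curveClass n z)) := by
  obtain ⟨a, b, c⟩ := z
  obtain ⟨h₁, h₂, h₃, h₄, h₅⟩ := hz
  simp only at h₁ h₂ h₃ h₄ h₅
  have hP : L (cP 2) = - L (cP 0) - L (cP 1) := by
    have h : L (cP 0) + L (cP 1) + L (cP 2) = 0 := (weight L hL).P_sum
    linear_combination h
  have hX : L (cX 1) = - L (cX 0) := by
    have h : L (cX 0) + L (cX 1) = 0 := (weight L hL).X_sum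
    linear_combination h
  have hp : (curveClass n (a, b, c)) = ![c - a, n - c - a, c - b, n - c - b,
    c - (n - a - b), n - c - (n - a - b)] := rfl
  have y11 : x11 = cX 0 - cP 0 := by simp [cX, cP]
  have y12 : x12 = cX 1 - cP 0 := by simp [cX, cP, x12]; ring
  have y21 : x21 = cX 0 - cP 1 := by simp [cX, cP]
  have y22 : x22 = cX 1 - cP 1 := by simp [cX, cP, x22]; ring
  have y31 : x31 = cX 0 - cP 2 := by simp [cX, cP]
  have y32 : x32 = cX 1 - cP 2 := by simp [cX, cP]; ring
  have yD1 : D1 = 2 * cX 0 := by simp [cX, D1, x22]; ring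
  have yD3 : D3 = 2 * cX 1 := by simp [cX, D3, x12]; ring
  have hN1 : D1 * ∏ m ∈ Finset.Icc (1 : ℤ) (2 * c), (D1 + Cc (m : ℚ)) = Num (2 * c) (2 * cX 0) := by
    rw [Num, if_pos (by omega), yD1]
  have hN3 : D3 * ∏ m ∈ Finset.Icc (1 : ℤ) (2 * (n - c)), (D3 + Cc (m : ℚ)) =
      Num (2 * (n - c)) (2 * cX 1) := by
    rw [Num, if_pos (by omega), yD3]
  rw [← map_prod_D2 hL]
  simp only [Weight.evalAt, Weight.slice, Weight.val, Weight.mono, Weight.symm, Weight.vdm, weight,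
    ← hN1, ← hN3, T, e1_curveClass, e2_curveClass, e3_curveClass,
    Cc_intCast]
  simp only [hp, Fin.isValue, Matrix.cons_val, map_mul, map_pow, map_add, map_sub, map_intCast,
    ← y11, ← y12, ← y21, ← y22, ← y31, ← y32]
  rw [congrArg L y11, congrArg L y21, congrArg L y31, congrArg L y12]
  simp only [map_sub, hP, hX]
  push_cast
  ring

/-- The leading moment computes the `I`-function. -/
theorem factorial_mul_mom {τ : K} (hτ : τ ^ 7 = 0) (hLτ : ∀ y, constantCoeff y = 0 → τ ∣ L y)
    (n : ℕ) : n.factorial * (weight L hL).mom n n 0 0 0 = L (D1 * D3 * F n) := by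
  have hfin := finiteSlices hL hτ hLτ n n (by omega) (by omega)
  have hE : ∑ᶠ z, (weight L hL).evalAt n n z (Weight.mono (0, 0, 0)) * (weight L hL).slice n n z =
      ∑ᶠ z ∈ effective n, (weight L hL).evalAt n n z (Weight.mono (0, 0, 0)) *
        (weight L hL).slice n n z := by
    rw [← finsum_mem_univ]
    refine finsum_mem_inter_support_eq' _ _ _ fun z hz => iff_of_true trivial ?_
    exact effective_of_slice_ne_zero hL hτ hLτ (by omega) (right_ne_zero_of_mul hz)
  rw [Weight.mom, Weight.S_eq_finsum hfin, hE, mul_finsum_mem' _ _ (finite_effective n), F,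
    mul_finsum_mem' _ _ (finite_effective_classes n)]
  refine (finsum_mem_eq_of_bijOn (curveClass n) (bijOn_curveClass n)
    (g := fun d => L (D1 * D3 * T d)) (fun z hz => map_T_curveClass hL n hz)).trans ?_
  exact (L.toAddMonoidHom.map_finsum_mem _ (finite_effective_classes n)).symm

end Moment

theorem hasSubst_line (v : Fin 4 → ℚ) :
    HasSubst (fun i => PowerSeries.C (v i) * PowerSeries.X : Fin 4 → MvPowerSeries Unit ℚ) :=
  hasSubst_of_constantCoeff_zero fun _ =>
    (map_mul _ _ _).trans (mul_eq_zero_of_right _ PowerSeries.constantCoeff_X)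

/-- Restriction of power series to the line spanned by `v`. -/
def line (v : Fin 4 → ℚ) : R →ₐ[ℚ] PowerSeries ℚ :=
  substAlgHom (hasSubst_line v)

theorem line_X (v : Fin 4 → ℚ) (i : Fin 4) :
    line v (X i) = PowerSeries.C (v i) * PowerSeries.X :=
  substAlgHom_X (hasSubst_line v) i

theorem X_dvd_line (v : Fin 4 → ℚ) {y : R} (hy : constantCoeff y = 0) :
    PowerSeries.X ∣ line v y := by
  rw [PowerSeries.X_dvd_iff, line, substAlgHom_apply]
  refine constantCoeff_subst_eq_zero (hasSubst_line v) (fun i => ?_) hy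
  exact (map_mul _ _ _).trans (mul_eq_zero_of_right _ PowerSeries.constantCoeff_X)

/-- The truncated power series ring `ℚ[t]/(t⁷)`. -/
abbrev Trunc := PowerSeries ℚ ⧸ Ideal.span {(PowerSeries.X : PowerSeries ℚ) ^ 7}

/-- The class of `t` in `ℚ[t]/(t⁷)`. -/
def τ : Trunc := Ideal.Quotient.mk _ PowerSeries.X

/-- Restriction of power series to a general line in the hyperplane `D₂ = 0`, truncated. -/
def spec : R →+* Trunc := (Ideal.Quotient.mk _).comp (line ![1, 0, 5, 1]).toRingHom

theorem spec_apply (y : R) : spec y = Ideal.Quotient.mk _ (line ![1, 0, 5, 1] y) := rfl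

theorem tau_pow : τ ^ 7 = 0 := by
  rw [τ, ← map_pow, Ideal.Quotient.eq_zero_iff_mem]
  exact Ideal.mem_span_singleton_self _

theorem tau_dvd_spec (y : R) (hy : constantCoeff y = 0) : τ ∣ spec y :=
  map_dvd _ (X_dvd_line _ hy)

theorem spec_C (q : ℚ) : spec (C q) = algebraMap ℚ Trunc q :=
  congrArg (Ideal.Quotient.mk _) ((line ![1, 0, 5, 1]).commutes q)

theorem spec_x11 : spec x11 = τ := by
  simp [spec_apply, x11, line_X, τ]

theorem spec_x21 : spec x21 = 0 := by
  simp [spec_apply, x21, line_X]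

theorem spec_x31 : spec x31 = 5 * τ := by
  simp [spec_apply, x31, line_X, τ,
    map_ofNat PowerSeries.C, map_ofNat (Ideal.Quotient.mk _)]

theorem spec_x32 : spec x32 = τ := by
  simp [spec_apply, x32, line_X, τ]

theorem spec_D2 : spec D2 = 0 := by
  simp only [D2, x12, x22, map_add, map_sub, spec_x11, spec_x21, spec_x31, spec_x32]
  ring

theorem spec_leading : spec (D1 * D3 * ω) = 1280 * τ ^ 6 := by
  simp only [D1, D3, ω, x12, x22, map_mul, map_add, map_sub, map_ofNat, spec_x11, spec_x21,
    spec_x31, spec_x32]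
  ring

theorem tau_pow_mul_spec (y : R) :
    τ ^ 6 * spec y = algebraMap ℚ Trunc (constantCoeff y) * τ ^ 6 := by
  obtain ⟨w, hw⟩ := tau_dvd_spec (y - C (constantCoeff y)) (by simp)
  rw [map_sub, spec_C] at hw
  linear_combination τ ^ 6 * hw + w * tau_pow

theorem eq_zero_of_mul_tau_pow {q : ℚ} (h : algebraMap ℚ Trunc q * τ ^ 6 = 0) : q = 0 := by
  have h' : Ideal.Quotient.mk (Ideal.span {(PowerSeries.X : PowerSeries ℚ) ^ 7})
      (PowerSeries.C q * PowerSeries.X ^ 6) = 0 := by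
    rw [map_mul, map_pow]
    exact h
  rw [Ideal.Quotient.eq_zero_iff_mem, Ideal.mem_span_singleton, PowerSeries.X_pow_dvd_iff] at h'
  simpa [PowerSeries.coeff_X_pow] using h' 6 (by norm_num)

/-- The specialised weight. -/
abbrev Ω₀ : Weight Trunc := weight spec spec_D2

theorem finiteSlices_Ω₀ : Ω₀.FiniteSlices := finiteSlices spec_D2 tau_pow tau_dvd_spec

theorem mom_eq {G : ℕ → R} (hG : ∀ n, F n = ω * G n) (n : ℕ) :
    Ω₀.mom n n 0 0 0 =
      algebraMap ℚ Trunc (1280 * (constantCoeff (G n) / n.factorial)) * τ ^ 6 := by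
  have h := factorial_mul_mom spec_D2 tau_pow tau_dvd_spec n
  rw [hG, ← mul_assoc, map_mul, spec_leading, mul_assoc, tau_pow_mul_spec] at h
  have hu : algebraMap ℚ Trunc ((n.factorial : ℚ)⁻¹) * (n.factorial : Trunc) = 1 := by
    rw [← map_natCast (algebraMap ℚ Trunc), ← map_mul, inv_mul_cancel₀ (by positivity), map_one]
  calc Ω₀.mom n n 0 0 0
      = algebraMap ℚ Trunc ((n.factorial : ℚ)⁻¹) * (n.factorial * Ω₀.mom n n 0 0 0) := by
        rw [← mul_assoc, hu, one_mul]
    _ = _ := by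
        rw [h, div_eq_mul_inv, map_mul, map_mul, map_ofNat]
        ring

theorem mom_neg_one (a b c : ℕ) : Ω₀.mom (-1) (-1) a b c = 0 := by
  rw [Weight.mom, Weight.S_eq_finsum (finiteSlices_Ω₀ _ _ (by omega) (by omega))]
  refine finsum_eq_zero_of_forall_eq_zero fun z => mul_eq_zero_of_right _ ?_
  by_contra h
  have := effective_of_slice_ne_zero spec_D2 tau_pow tau_dvd_spec le_rfl h
  omega

theorem mom_zero_pairs : Ω₀.mom 0 0 1 0 0 = 0 := by
  rw [Weight.mom, Weight.S_eq_finsum (finiteSlices_Ω₀ _ _ (by omega) (by omega))]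
  refine finsum_eq_zero_of_forall_eq_zero fun z => ?_
  by_contra h
  obtain ⟨a, b, c⟩ := z
  have := effective_of_slice_ne_zero spec_D2 tau_pow tau_dvd_spec (by omega)
    (right_ne_zero_of_mul h)
  obtain ⟨rfl, rfl, rfl⟩ : a = 0 ∧ b = 0 ∧ c = 0 := by omega
  apply h
  obtain ⟨w, hw⟩ := dvd_weight_N spec_D2 tau_dvd_spec 0 le_rfl
  simp only [Weight.evalAt, Weight.slice, Weight.val, Weight.mono, Weight.symm, Weight.vdm]
  rw [show (0 : ℤ) - 0 = 0 from rfl, hw]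
  simp only [weight, cP, cX, Matrix.cons_val, map_add, spec_x11, spec_x21, spec_x32]
  push_cast
  ring_nf
  simp [tau_pow]

theorem G_zero {G : ℕ → R} (hG : ∀ n, F n = ω * G n) : G 0 = 1 := by
  have hset : {d : Fin 6 → ℤ | d ∈ NE ∧ deg d = ((0 : ℕ) : ℤ)} = {0} := by
    rw [← (bijOn_curveClass _).image_eq, show effective ((0 : ℕ) : ℤ) = {(0, 0, 0)} by
      ext ⟨a, b, c⟩
      simp only [effective, Set.mem_ofPred_eq, Set.mem_singleton_iff, Prod.mk.injEq]
      omega, Set.image_singleton, Set.singleton_eq_singleton_iff]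
    funext i
    fin_cases i <;> rfl
  have hF : F 0 = ω := by
    rw [F, hset, finsum_mem_singleton]
    simp [T, e1, e2, e3, deg, Phi, ω, Cc]
  have hω : ω ≠ 0 := by
    intro h
    have := spec_leading
    rw [h, mul_zero, map_zero] at this
    have h0 := eq_zero_of_mul_tau_pow (q := 1280) (by rw [map_ofNat]; exact this.symm)
    norm_num at h0
  have := hG 0
  rw [hF] at this
  exact (mul_left_cancel₀ hω (this.symm.trans (mul_one ω).symm))

theorem Weight.mom_recurrence {K : Type*} [CommRing K] {Ω : Weight K} (hΩ : Ω.FiniteSlices)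
    {n : ℤ} (hn : 0 ≤ n) {w : K}
    (h : 3 * Ω.mom n n 1 0 0 =
      (n : K) ^ 2 * Ω.mom n n 0 0 0 + (4 * (n : K) + 2) * Ω.mom (n - 1) (n - 1) 0 0 0)
    (h' : 3 * Ω.mom (n - 1) (n - 1) 1 0 0 =
      ((n : K) - 1) ^ 2 * Ω.mom (n - 1) (n - 1) 0 0 0 + (4 * (n : K) - 2) * w) :
    ((n : K) + 1) ^ 5 * Ω.mom (n + 1) (n + 1) 0 0 0 +
      2 * (2 * (n : K) ^ 2 + 2 * (n : K) + 1) * (11 * (n : K) ^ 2 + 11 * (n : K) + 3) *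
        Ω.mom n n 0 0 0 +
      4 * (n : K) * (76 * (n : K) ^ 2 + 35) * Ω.mom (n - 1) (n - 1) 0 0 0 +
      144 * (2 * (n : K) - 1) ^ 2 * w = 0 := by
  linear_combination -3 * mom_fifth hΩ hn - 19 * ((n : K) + 1) ^ 3 * mom_pairs hΩ hn -
    (112 * (n : K) ^ 2 + 106 * (n : K) + 36) * h + (72 - 144 * (n : K)) * h'

theorem rat_recurrence {n : ℤ} {x y z w : ℚ}
    (h : ((n : Trunc) + 1) ^ 5 * (algebraMap ℚ Trunc (1280 * x) * τ ^ 6) +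
      2 * (2 * (n : Trunc) ^ 2 + 2 * (n : Trunc) + 1) *
        (11 * (n : Trunc) ^ 2 + 11 * (n : Trunc) + 3) * (algebraMap ℚ Trunc (1280 * y) * τ ^ 6) +
      4 * (n : Trunc) * (76 * (n : Trunc) ^ 2 + 35) *
        (algebraMap ℚ Trunc (1280 * z) * τ ^ 6) +
      144 * (2 * (n : Trunc) - 1) ^ 2 * (algebraMap ℚ Trunc (1280 * w) * τ ^ 6) = 0) :
    ((n : ℚ) + 1) ^ 5 * x +
      2 * (2 * (n : ℚ) ^ 2 + 2 * (n : ℚ) + 1) * (11 * (n : ℚ) ^ 2 + 11 * (n : ℚ) + 3) * y +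
      4 * (n : ℚ) * (76 * (n : ℚ) ^ 2 + 35) * z + 144 * (2 * (n : ℚ) - 1) ^ 2 * w = 0 := by
  refine (mul_eq_zero_iff_left (by norm_num : (1280 : ℚ) ≠ 0)).mp (eq_zero_of_mul_tau_pow ?_)
  simp only [map_mul, map_add, map_sub, map_pow, map_intCast, map_ofNat, map_one] at h ⊢
  linear_combination h

/-- The recurrence for the leading coefficients of `F_δ / ω`. -/
theorem recurrence {G : ℕ → R} (hG : ∀ n, F n = ω * G n) (n : ℕ) :
    ((n : ℚ) + 1) ^ 4 * constantCoeff (G (n + 1)) +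
      2 * (2 * (n : ℚ) ^ 2 + 2 * (n : ℚ) + 1) * (11 * (n : ℚ) ^ 2 + 11 * (n : ℚ) + 3) *
        constantCoeff (G n) +
      4 * (n : ℚ) ^ 2 * (76 * (n : ℚ) ^ 2 + 35) * constantCoeff (G (n - 1)) +
      144 * (2 * (n : ℚ) - 1) ^ 2 * (n * (n - 1)) * constantCoeff (G (n - 2)) = 0 := by
  have u := mom_eq hG
  rcases n with - | - | n
  · have h := Weight.mom_recurrence finiteSlices_Ω₀ (n := 0) le_rfl (w := 0)
      (by simp [mom_zero_pairs, mom_neg_one]) (by simp [mom_neg_one])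
    have h' := rat_recurrence (n := 0) (x := constantCoeff (G 1) / Nat.factorial 1)
      (y := constantCoeff (G 0) / Nat.factorial 0)
      (z := 0) (w := 0) (by
        rw [← u, ← u]
        simpa [mom_neg_one] using h)
    simpa using h'
  · have h := Weight.mom_recurrence finiteSlices_Ω₀ (n := 1) zero_le_one (w := 0)
      (by convert Weight.mom_pairs finiteSlices_Ω₀ (n := 0) le_rfl using 2 <;> norm_num)
      (by simp [mom_zero_pairs])
    have h' := rat_recurrence (n := 1) (x := constantCoeff (G 2) / Nat.factorial 2)
      (y := constantCoeff (G 1) / Nat.factorial 1)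
      (z := constantCoeff (G 0) / Nat.factorial 0) (w := 0) (by
        rw [← u, ← u, ← u]
        simpa using h)
    norm_num [Nat.factorial] at h' ⊢
    linear_combination h'
  · have h := Weight.mom_recurrence finiteSlices_Ω₀ (n := n + 2) (by omega)
      (w := Ω₀.mom n n 0 0 0) (by
        have := Weight.mom_pairs finiteSlices_Ω₀ (n := n + 1) (by omega)
        rw [show (n : ℤ) + 1 + 1 = n + 2 by ring] at this
        rw [show (n : ℤ) + 2 - 1 = n + 1 by ring, this]
        push_cast
        ring)
      (by
        have := Weight.mom_pairs finiteSlices_Ω₀ (n := n) (by omega)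
        rw [show (n : ℤ) + 2 - 1 = n + 1 by ring, this]
        push_cast
        ring)
    have h' := rat_recurrence (n := n + 2) (x := constantCoeff (G (n + 3)) / (n + 3).factorial)
      (y := constantCoeff (G (n + 2)) / (n + 2).factorial)
      (z := constantCoeff (G (n + 1)) / (n + 1).factorial)
      (w := constantCoeff (G n) / n.factorial) (by
        rw [← u, ← u, ← u, ← u, ← h]
        push_cast
        rw [show (n : ℤ) + 2 - 1 = n + 1 by ring, show (n : ℤ) + 2 + 1 = n + 3 by ring])
    simp only [Nat.factorial_succ, Nat.add_one_sub_one] at h' ⊢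
    have hf : (n.factorial : ℚ) ≠ 0 := by positivity
    have h₁ : (n : ℚ) + 1 ≠ 0 := by positivity
    have h₂ : (n : ℚ) + 2 ≠ 0 := by positivity
    have h₃ : (n : ℚ) + 3 ≠ 0 := by positivity
    push_cast at h' ⊢
    rw [show (n : ℚ) + 1 + 1 = n + 2 by ring, show (n : ℚ) + 2 + 1 = n + 3 by ring] at *
    field_simp at h'
    linear_combination h'

theorem coeff_ofNat_mul (k n : ℕ) [k.AtLeastTwo] (f : PowerSeries ℚ) :
    PowerSeries.coeff n ((ofNat(k) : PowerSeries ℚ) * f) =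
      (ofNat(k) : ℚ) * PowerSeries.coeff n f := by
  rw [← map_ofNat PowerSeries.C, PowerSeries.coeff_C_mul]

theorem coeff_th (n : ℕ) (f : PowerSeries ℚ) :
    PowerSeries.coeff n (th f) = (n : ℚ) * PowerSeries.coeff n f :=
  PowerSeries.coeff_mk _ _

/-- A recurrence for the coefficients amounts to the Picard–Fuchs equation. -/
theorem picardFuchs {a : ℕ → ℚ} (ha : ∀ n : ℕ, ((n : ℚ) + 1) ^ 4 * a (n + 1) -
      2 * (2 * (n : ℚ) ^ 2 + 2 * (n : ℚ) + 1) * (11 * (n : ℚ) ^ 2 + 11 * (n : ℚ) + 3) * a n +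
      4 * (n : ℚ) ^ 2 * (76 * (n : ℚ) ^ 2 + 35) * a (n - 1) -
      144 * (2 * (n : ℚ) - 1) ^ 2 * (n * (n - 1)) * a (n - 2) = 0)
    {f : PowerSeries ℚ} (hf : f = PowerSeries.mk a) :
    th^[4] f -
      2 * PowerSeries.X *
        (2 * th^[2] ((11 : PowerSeries ℚ) * th^[2] f + 11 * th f + 3 * f) +
          2 * th (11 * th^[2] f + 11 * th f + 3 * f) +
          (11 * th^[2] f + 11 * th f + 3 * f)) +
      4 * PowerSeries.X ^ 2 *
        ((fun g => th g + g) ((fun g => th g + g)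
          (76 * th^[2] f + 152 * th f + 111 * f))) -
      144 * PowerSeries.X ^ 3 *
        ((fun g => th g + g) ((fun g => th g + 2 * g)
          ((fun g => 2 * th g + 3 * g) ((fun g => 2 * th g + 3 * g) f)))) = 0 := by
  have hc (n : ℕ) : PowerSeries.coeff n f = a n := by rw [hf, PowerSeries.coeff_mk]
  have hX (n : ℕ) (g : PowerSeries ℚ) : PowerSeries.coeff n (PowerSeries.X * g) =
      if 1 ≤ n then PowerSeries.coeff (n - 1) g else 0 := by
    simpa using PowerSeries.coeff_X_pow_mul' g 1 n
  ext n
  simp only [Function.iterate_succ, Function.iterate_zero, Function.comp_apply, id_eq, mul_assoc,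
    map_add, map_sub, coeff_ofNat_mul, coeff_th, hX, PowerSeries.coeff_X_pow_mul', hc, map_zero]
  rcases n with - | - | - | n
  · simp
  · have := ha 0
    norm_num at this ⊢
    linear_combination this
  · have := ha 1
    norm_num at this ⊢
    linear_combination this
  · have := ha (n + 2)
    simp only [Nat.add_one_sub_one, show n + 1 + 1 + 1 - 2 = n + 1 by omega,
      show n + 1 + 1 + 1 - 3 = n by omega] at this ⊢
    norm_num at this ⊢
    linear_combination this

theorem coefficients {G : ℕ → R} (hG : ∀ n, F n = ω * G n) {a : ℕ → ℚ}
    (ha : ∀ n, a n = (-1 : ℚ) ^ n * MvPowerSeries.constantCoeff (G n)) (n : ℕ) :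
    ((n : ℚ) + 1) ^ 4 * a (n + 1) -
      2 * (2 * (n : ℚ) ^ 2 + 2 * (n : ℚ) + 1) * (11 * (n : ℚ) ^ 2 + 11 * (n : ℚ) + 3) * a n +
      4 * (n : ℚ) ^ 2 * (76 * (n : ℚ) ^ 2 + 35) * a (n - 1) -
      144 * (2 * (n : ℚ) - 1) ^ 2 * (n * (n - 1)) * a (n - 2) = 0 := by
  have h := recurrence hG n
  simp only [ha]
  rcases n with - | - | n
  · norm_num at h ⊢
    linear_combination -h
  · norm_num at h ⊢
    linear_combination h
  · simp only [Nat.add_one_sub_one, show n + 1 + 1 - 2 = n by omega] at h ⊢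
    linear_combination -(-1) ^ n * h

theorem hasSubst_update (i : Fin 4) {y : R} (hy : constantCoeff y = 0) :
    HasSubst (Function.update X i y : Fin 4 → R) :=
  hasSubst_of_constantCoeff_zero fun k => by
    rcases eq_or_ne k i with rfl | h
    · simpa using hy
    · simp [h]

/-- Substitution of `y` for the variable `xᵢ`. -/
def replace (i : Fin 4) {y : R} (hy : constantCoeff y = 0) : R →ₐ[ℚ] R :=
  substAlgHom (hasSubst_update i hy)

theorem replace_X (i k : Fin 4) {y : R} (hy : constantCoeff y = 0) :
    replace i hy (X k) = if k = i then y else X k := by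
  rw [replace, substAlgHom_X, Function.update_apply]

theorem coeff_replace_zero {i : Fin 4} (f : R) {e : Fin 4 →₀ ℕ} (he : e i = 0) :
    coeff e (replace i (map_zero constantCoeff) f) = coeff e f := by
  rw [replace, substAlgHom_apply, coeff_subst (hasSubst_update i (map_zero constantCoeff)),
    finsum_eq_single _ e]
  · rw [show (e.prod fun s n => Function.update X i (0 : R) s ^ n) = monomial e 1 by
      rw [monomial_eq', map_one, one_mul]
      exact Finsupp.prod_congr fun s hs => by
        rw [Function.update_of_ne (by rintro rfl; simp [he] at hs)]]
    simp
  · intro d hd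
    by_cases hdi : d i = 0
    · rw [show (d.prod fun s n => Function.update X i (0 : R) s ^ n) = monomial d 1 by
        rw [monomial_eq', map_one, one_mul]
        exact Finsupp.prod_congr fun s hs => by
          rw [Function.update_of_ne (by rintro rfl; simp [hdi] at hs)],
        coeff_monomial_ne hd.symm, smul_zero]
    · rw [Finsupp.prod, Finset.prod_eq_zero (Finsupp.mem_support_iff.mpr hdi) (by simp [hdi]),
        map_zero, smul_zero]

theorem X_dvd_of_replace_zero {i : Fin 4} {f : R}
    (h : replace i (map_zero constantCoeff) f = 0) : X i ∣ f :=
  X_dvd_iff.mpr fun m hm => by rw [← coeff_replace_zero f hm, h, map_zero]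

theorem replace_replace_sub {i j : Fin 4} (hij : i ≠ j) (f : R) :
    replace i (y := X i - X j) (by simp) (replace i (y := X i + X j) (by simp) f) = f := by
  rw [replace, replace, substAlgHom_comp_substAlgHom_apply, substAlgHom_apply]
  conv_rhs => rw [← id_eq f, ← subst_self]
  congr 1
  funext k
  rcases eq_or_ne k i with rfl | h
  · rw [Function.update_self, map_add, substAlgHom_X, substAlgHom_X]
    simp [hij.symm]
  · rw [Function.update_of_ne h, substAlgHom_X, Function.update_of_ne h]

/-- Restriction to the hyperplane `xᵢ = xⱼ`. -/
def restrict (i j : Fin 4) : R →ₐ[ℚ] R :=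
  (replace i (map_zero constantCoeff)).comp (replace i (y := X i + X j) (by simp))

theorem restrict_X {i j : Fin 4} (hij : i ≠ j) (k : Fin 4) :
    restrict i j (X k) = if k = i then X j else X k := by
  rw [restrict, AlgHom.comp_apply, replace_X]
  split_ifs with h
  · simp [replace_X, hij.symm]
  · simp [replace_X, h]

theorem dvd_of_restrict_eq_zero {i j : Fin 4} (hij : i ≠ j) {f : R} (h : restrict i j f = 0) :
    X i - X j ∣ f := by
  have h' : X i ∣ replace i (y := X i + X j) (by simp) f := X_dvd_of_replace_zero h
  have := map_dvd (replace i (y := X i - X j) (by simp)) h'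
  rwa [replace_replace_sub hij, replace_X, if_pos rfl] at this

theorem map_inv_of_constantCoeff_ne_zero (π : R →ₐ[ℚ] R) {u : R} (hu : constantCoeff u ≠ 0) :
    π u⁻¹ = (π u)⁻¹ := by
  have h : π u⁻¹ * π u = 1 := by rw [← map_mul, MvPowerSeries.inv_mul_cancel _ hu, map_one]
  refine (MvPowerSeries.eq_inv_iff_mul_eq_one fun h₀ => ?_).mpr h
  simpa [h₀] using congrArg constantCoeff h

theorem map_Cc (π : R →ₐ[ℚ] R) (q : ℚ) : π (Cc q) = Cc q := π.commutes q

theorem map_Phi (π : R →ₐ[ℚ] R) {y : R} (hy : constantCoeff y = 0) (e : ℤ) :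
    π (Phi e y) = Phi e (π y) := by
  unfold Phi
  split_ifs
  · rw [map_inv_of_constantCoeff_ne_zero π (constantCoeff_prod_ne_zero hy (by simp))]
    simp [map_prod, map_Cc]
  · simp [map_prod, map_Cc]

theorem F_eq_sum (n : ℕ) : F n = ∑ z ∈ (finite_effective n).toFinset, T (curveClass n z) := by
  rw [F, ← finsum_mem_eq_of_bijOn (curveClass n) (bijOn_curveClass n) (fun z _ => rfl),
    finsum_mem_eq_finite_toFinset_sum _ (finite_effective n)]

theorem map_T (π : R →ₐ[ℚ] R) (n a b c : ℤ) :
    π (T (curveClass n (a, b, c))) =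
      (π x11 - π x21 + Cc ((b - a : ℤ) : ℚ)) * (π x11 - π x31 + Cc ((n - a - b - a : ℤ) : ℚ)) *
      (π x21 - π x31 + Cc ((n - a - b - b : ℤ) : ℚ)) *
      (π x12 - π x11 + Cc ((n - c - c : ℤ) : ℚ)) *
      (∏ m ∈ Finset.Icc (1 : ℤ) (2 * c), (π D1 + Cc (m : ℚ))) *
      (∏ m ∈ Finset.Icc (1 : ℤ) n, (π D2 + Cc (m : ℚ))) *
      (∏ m ∈ Finset.Icc (1 : ℤ) (2 * (n - c)), (π D3 + Cc (m : ℚ))) *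
      Phi (c - a) (π x11) ^ 3 * Phi (n - c - a) (π x12) ^ 3 * Phi (c - b) (π x21) ^ 3 *
      Phi (n - c - b) (π x22) ^ 3 * Phi (c - (n - a - b)) (π x31) ^ 3 *
      Phi (n - c - (n - a - b)) (π x32) ^ 3 := by
  rw [T, e1_curveClass, e2_curveClass, e3_curveClass]
  simp only [curveClass, Fin.isValue, Matrix.cons_val, map_mul, map_pow, map_add, map_sub,
    map_prod, map_Cc]
  rw [map_Phi π (by simp [x11]), map_Phi π (by simp [x12, x11, x31, x32]),
    map_Phi π (by simp [x21]), map_Phi π (by simp [x22, x21, x31, x32]),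
    map_Phi π (by simp [x31]), map_Phi π (by simp [x32]),
    show c - a - (c - b) = b - a by ring, show c - a - (c - (n - a - b)) = n - a - b - a by ring,
    show c - b - (c - (n - a - b)) = n - a - b - b by ring,
    show n - c - a - (c - a) = n - c - c by ring]

theorem map_F_eq_zero (π : R →ₐ[ℚ] R) (n : ℕ) (ι : ℤ × ℤ × ℤ → ℤ × ℤ × ℤ)
    (hι : ∀ z ∈ effective n, ι z ∈ effective n) (hιι : ∀ z, ι (ι z) = z)
    (hT : ∀ z, π (T (curveClass n (ι z))) = -π (T (curveClass n z))) : π (F n) = 0 := by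
  rw [F_eq_sum, map_sum]
  refine Finset.sum_involution (fun z _ => ι z) (fun z _ => ?_) (fun z _ h h' => h ?_)
    (fun z hz => ?_) (fun z _ => hιι z)
  · rw [hT, add_neg_cancel]
  · have := hT z
    rw [h'] at this
    refine (mul_eq_zero.mp (?_ : (2 : R) * π (T (curveClass n z)) = 0)).resolve_left
      fun h₂ => ?_
    · linear_combination this
    · have := congrArg constantCoeff h₂
      rw [map_ofNat, map_zero] at this
      exact two_ne_zero this
  · simpa using hι z (by simpa using hz)

theorem restrict_F_rows12 (n : ℕ) : restrict 0 1 (F n) = 0 := by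
  have h (k) := restrict_X (show (0 : Fin 4) ≠ 1 by decide) k
  refine map_F_eq_zero _ n (fun z => (z.2.1, z.1, z.2.2)) ?_ (fun _ => rfl) ?_
  · rintro ⟨a, b, c⟩ hz
    simp only [effective, Set.mem_ofPred_eq] at hz ⊢
    omega
  · rintro ⟨a, b, c⟩
    rw [map_T, map_T]
    have h₁ : restrict 0 1 x11 = restrict 0 1 x21 := by simp [x11, x21, h]
    have h₂ : restrict 0 1 x12 = restrict 0 1 x22 := by simp only [x12, x22, map_add, map_sub, h₁]
    rw [h₁, h₂, sub_right_comm (n : ℤ) b a]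
    simp only [Cc_intCast]
    push_cast
    ring

theorem restrict_F_rows13 (n : ℕ) : restrict 0 2 (F n) = 0 := by
  have h (k) := restrict_X (show (0 : Fin 4) ≠ 2 by decide) k
  refine map_F_eq_zero _ n (fun z => (n - z.1 - z.2.1, z.2.1, z.2.2)) ?_ (fun z => ?_) ?_
  · rintro ⟨a, b, c⟩ hz
    simp only [effective, Set.mem_ofPred_eq] at hz ⊢
    omega
  · exact Prod.ext (by dsimp only; ring) rfl
  · rintro ⟨a, b, c⟩
    rw [map_T, map_T]
    have h₁ : restrict 0 2 x11 = restrict 0 2 x31 := by simp [x11, x31, h]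
    have h₂ : restrict 0 2 x12 = restrict 0 2 x32 := by simp [x12, h₁]
    rw [h₁, h₂, show (n : ℤ) - (n - a - b) - b = a by ring]
    simp only [Cc_intCast]
    push_cast
    ring

theorem restrict_F_rows23 (n : ℕ) : restrict 1 2 (F n) = 0 := by
  have h (k) := restrict_X (show (1 : Fin 4) ≠ 2 by decide) k
  refine map_F_eq_zero _ n (fun z => (z.1, n - z.1 - z.2.1, z.2.2)) ?_ (fun z => ?_) ?_
  · rintro ⟨a, b, c⟩ hz
    simp only [effective, Set.mem_ofPred_eq] at hz ⊢
    omega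
  · ext <;> simp
  · rintro ⟨a, b, c⟩
    rw [map_T, map_T]
    have h₁ : restrict 1 2 x21 = restrict 1 2 x31 := by simp [x21, x31, h]
    have h₂ : restrict 1 2 x22 = restrict 1 2 x32 := by simp [x22, h₁]
    rw [h₁, h₂, show (n : ℤ) - a - (n - a - b) = b by ring]
    simp only [Cc_intCast]
    push_cast
    ring

theorem restrict_F_columns (n : ℕ) : restrict 3 2 (F n) = 0 := by
  have h (k) := restrict_X (show (3 : Fin 4) ≠ 2 by decide) k
  refine map_F_eq_zero _ n (fun z => (z.1, z.2.1, n - z.2.2)) ?_ (fun z => ?_) ?_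
  · rintro ⟨a, b, c⟩ hz
    simp only [effective, Set.mem_ofPred_eq] at hz ⊢
    omega
  · ext <;> simp
  · rintro ⟨a, b, c⟩
    rw [map_T, map_T]
    have h₁ : restrict 3 2 x32 = restrict 3 2 x31 := by simp [x32, x31, h]
    have h₂ : restrict 3 2 x12 = restrict 3 2 x11 := by simp [x12, h₁]
    have h₃ : restrict 3 2 x22 = restrict 3 2 x21 := by simp [x22, h₁]
    have h₄ : restrict 3 2 D3 = restrict 3 2 D1 := by
      simp only [D1, D3, map_add, map_mul, h₁, h₂, h₃]
    rw [h₁, h₂, h₃, h₄, sub_sub_cancel (n : ℤ) c]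
    simp only [Cc_intCast]
    push_cast
    ring

theorem X_sub_X_ne_zero {i j : Fin 4} (h : i ≠ j) : (X i - X j : R) ≠ 0 :=
  sub_ne_zero.mpr (X_inj.not.mpr h)

theorem dvd_cofactor {i j : Fin 4} (hij : i ≠ j) {f g : R} (hfg : restrict i j (f * g) = 0)
    (hf : restrict i j f ≠ 0) : ∃ k, g = (X i - X j) * k := by
  rw [map_mul] at hfg
  exact dvd_of_restrict_eq_zero hij ((mul_eq_zero.mp hfg).resolve_left hf)

theorem exists_F_eq_mul (n : ℕ) : ∃ G, F n = ω * G := by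
  obtain ⟨g, hg⟩ := dvd_of_restrict_eq_zero (by decide) (restrict_F_rows12 n)
  have h₂ := restrict_F_rows13 n
  have h₃ := restrict_F_rows23 n
  have h₄ := restrict_F_columns n
  rw [hg] at h₂ h₃ h₄
  obtain ⟨g, rfl⟩ := dvd_cofactor (by decide) h₂ (by
    simpa [restrict_X] using X_sub_X_ne_zero (show (2 : Fin 4) ≠ 1 by decide))
  rw [← mul_assoc] at h₃ h₄
  obtain ⟨g, rfl⟩ := dvd_cofactor (by decide) h₃ (by
    simpa [restrict_X] using X_sub_X_ne_zero (show (0 : Fin 4) ≠ 2 by decide))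
  rw [← mul_assoc] at h₄
  obtain ⟨g, rfl⟩ := dvd_cofactor (by decide) h₄ (by
    simp [restrict_X, X_sub_X_ne_zero])
  exact ⟨g, by rw [hg, ω, x12, x11, x21, x31, x32]; ring⟩

end Specialization

/-- (i) each `{d ∈ NE | δ(d) = δ}` is finite; (ii) each `F_δ` is divisible
by `ω` in `R`; (iii) with `a_δ = (−1)^δ · (F_δ/ω)(0)` one has `a₀ = 1`, `a₁ = 6`, `a₂ = 66`,
`a₃ = 1092`, and `I₀ = Σ a_δ q^δ` is annihilated by
`θ⁴ − 2q(2θ²+2θ+1)(11θ²+11θ+3) + 4q²(θ+1)²(76θ²+152θ+111) − 144q³(θ+1)(θ+2)(2θ+3)²`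
(the conjectural Picard–Fuchs operator of Calabi–Yau No. 18). -/
theorem stmt_14 :
    (∀ δ : ℕ, {d : Fin 6 → ℤ | d ∈ NE ∧ deg d = (δ : ℤ)}.Finite) ∧
    (∀ δ : ℕ, ∃ G : R, F δ = ω * G) ∧
    (∀ G : ℕ → R, (∀ δ : ℕ, F δ = ω * G δ) →
      ∀ a : ℕ → ℚ,
        (∀ δ : ℕ, a δ = (-1 : ℚ) ^ δ * MvPowerSeries.constantCoeff (G δ)) →
        a 0 = 1 ∧ a 1 = 6 ∧ a 2 = 66 ∧ a 3 = 1092 ∧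
        (∀ I₀ : PowerSeries ℚ, I₀ = PowerSeries.mk a →
          th^[4] I₀ -
            2 * PowerSeries.X *
              (2 * th^[2] ((11 : PowerSeries ℚ) * th^[2] I₀ + 11 * th I₀ + 3 * I₀) +
                2 * th (11 * th^[2] I₀ + 11 * th I₀ + 3 * I₀) +
                (11 * th^[2] I₀ + 11 * th I₀ + 3 * I₀)) +
            4 * PowerSeries.X ^ 2 *
              ((fun g => th g + g) ((fun g => th g + g)
                (76 * th^[2] I₀ + 152 * th I₀ + 111 * I₀))) -
            144 * PowerSeries.X ^ 3 *
              ((fun g => th g + g) ((fun g => th g + 2 * g)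
                ((fun g => 2 * th g + 3 * g) ((fun g => 2 * th g + 3 * g) I₀)))) = 0)) := by
  refine ⟨fun δ => finite_effective_classes δ, exists_F_eq_mul, fun G hG a ha => ?_⟩
  have h := coefficients hG ha
  have h₀ : a 0 = 1 := by rw [ha, G_zero hG]; simp
  have h₁ : a 1 = 6 := by
    have := h 0
    norm_num [h₀] at this
    linarith
  have h₂ : a 2 = 66 := by
    have := h 1
    norm_num [h₀, h₁] at this
    linarith
  have h₃ : a 3 = 1092 := by
    have := h 2
    norm_num [h₀, h₁, h₂] at this
    linarith
  exact ⟨h₀, h₁, h₂, h₃, fun _ hf => picardFuchs h hf⟩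

end Stmt14
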